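/- arXiv:1211.2520 — 6 statements merged into one kernel-verified Lean document; each statement's English description precedes it below -/
import Mathlib

section
/- Let L(u) = Σ_{i,j=1}^{n+1} a_{ij}(x)∂_{ij}u + Σ_{i=1}^{n} b_i(x)∂_iu + (a(x)/x_{n+1})∂_{n+1}u, where a_{ij}, b_i, a ∈ C(ℝ^{n+1}), a(x) ≥ 0 everywhere, and (a_{ij}(x)) is positive definite. Suppose u ∈ C²(B₁) ∩ C(closure B₁), where B₁ ⊂ ℝ^{n+1} is the open unit ball, satisfies ∂_{n+1}u(x',0) = 0 whenever (x',0) ∈ B₁, and −L(u) ≥ 0 at every point of B₁ with x_{n+1} ≠ 0. Then either u is constant on B₁ or u does not attain its minimum over closure B₁ at any point of the open ball B₁. -/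
/-- First partial derivative in the `i`-th coordinate direction. -/
noncomputable def pd {m : ℕ} (f : EuclideanSpace ℝ (Fin m) → ℝ) (i : Fin m)
    (x : EuclideanSpace ℝ (Fin m)) : ℝ :=
  fderiv ℝ f x (EuclideanSpace.single i 1)

/-- Second partial derivative in the coordinate directions `i`, `j`. -/
noncomputable def pd2 {m : ℕ} (f : EuclideanSpace ℝ (Fin m) → ℝ) (i j : Fin m)
    (x : EuclideanSpace ℝ (Fin m)) : ℝ :=
  pd (fun z => pd f j z) i x

open Filter Topology


lemma second_test {g : ℝ → ℝ} (hg : IsLocalMin g 0) (hc : ContinuousAt g 0) :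
    0 ≤ deriv (deriv g) 0 := by
  by_contra! h
  have h1 : IsLocalMin (-g) 0 := by
    apply isLocalMin_of_deriv_deriv_pos
    · have : deriv (-g) = -deriv g := by ext x; simp
      rw [this]
      have : deriv (-deriv g) = -deriv (deriv g) := by ext x; simp
      rw [this]; simpa using h
    · simpa using hg.deriv_eq_zero
    · exact hc.neg
  have h2 : g =ᶠ[𝓝 0] fun _ => g 0 := by
    filter_upwards [hg, h1] with x hx hx'
    simp at hx'
    linarith
  have h3 := h2.deriv
  have h4 := h3.deriv_eq
  simp at h4
  linarith

lemma pd2_eq {m : ℕ} {f : EuclideanSpace ℝ (Fin m) → ℝ} {z : EuclideanSpace ℝ (Fin m)}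
    (hf : ContDiffAt ℝ 2 f z) (i j : Fin m) :
    pd2 f i j z = fderiv ℝ (fderiv ℝ f) z (EuclideanSpace.single i 1) (EuclideanSpace.single j 1) := by
  have hd : DifferentiableAt ℝ (fderiv ℝ f) z :=
    (hf.fderiv_right (m := 1) (by norm_num)).differentiableAt (by norm_num)
  unfold pd2 pd
  rw [fderiv_clm_apply hd (by fun_prop)]
  simp

lemma trace_nonneg {m : ℕ} (B H : Fin m → Fin m → ℝ)
    (hB : ∀ v : Fin m → ℝ, v ≠ 0 → 0 < ∑ i, ∑ j, B i j * v i * v j)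
    (hs : ∀ i j, H i j = H j i)
    (hH : ∀ v : Fin m → ℝ, 0 ≤ ∑ i, ∑ j, v i * v j * H i j) :
    0 ≤ ∑ i, ∑ j, B i j * H i j := by
  have hp : (Matrix.of H).PosSemidef := by
    apply Matrix.PosSemidef.of_dotProduct_mulVec_nonneg
    · ext i j; simp [hs i j]
    · intro v
      have e : star v ⬝ᵥ (Matrix.of H).mulVec v = ∑ i, ∑ j, v i * v j * H i j := by
        simp only [dotProduct, Matrix.mulVec, Finset.mul_sum, Matrix.of_apply, Pi.star_apply,
          star_trivial]
        refine Finset.sum_congr rfl fun i _ => Finset.sum_congr rfl fun j _ => ?_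
        ring
      rw [e]; exact hH v
  obtain ⟨p, C, hC⟩ := Matrix.posSemidef_iff_eq_sum_vecMulVec.1 hp
  have hij : ∀ i j, H i j = ∑ k, C k i * C k j := by
    intro i j
    have := congrFun (congrFun hC i) j
    simpa [Matrix.sum_apply, Matrix.vecMulVec_apply] using this
  have : ∑ i, ∑ j, B i j * H i j = ∑ k, ∑ i, ∑ j, B i j * C k i * C k j := by
    simp only [hij, Finset.mul_sum]
    conv_rhs => rw [Finset.sum_comm]
    refine Finset.sum_congr rfl fun i _ => ?_
    rw [Finset.sum_comm]
    refine Finset.sum_congr rfl fun i _ => Finset.sum_congr rfl fun j _ => ?_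
    ring
  rw [this]
  refine Finset.sum_nonneg fun k _ => ?_
  by_cases h0 : C k = 0
  · simp [h0]
  · exact (hB _ h0).le

lemma min_test {m : ℕ} {f : EuclideanSpace ℝ (Fin m) → ℝ} {z : EuclideanSpace ℝ (Fin m)}
    (hf : ContDiffAt ℝ 2 f z) (hz : IsLocalMin f z) (B : Fin m → Fin m → ℝ)
    (hB : ∀ v : Fin m → ℝ, v ≠ 0 → 0 < ∑ i, ∑ j, B i j * v i * v j) :
    0 ≤ ∑ i, ∑ j, B i j * pd2 f i j z := by
  have hd : DifferentiableAt ℝ (fderiv ℝ f) z :=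
    (hf.fderiv_right (m := 1) (by norm_num)).differentiableAt (by norm_num)
  apply trace_nonneg _ _ hB
  · intro i j
    rw [pd2_eq hf, pd2_eq hf]
    exact (hf.isSymmSndFDerivAt (by simp)).eq _ _
  · intro v
    set V : EuclideanSpace ℝ (Fin m) := WithLp.toLp 2 v
    have hV : V = ∑ i, v i • EuclideanSpace.single i (1:ℝ) := by
      ext k; simp [V, Pi.single_apply]
    have h1 : ∑ i, ∑ j, v i * v j * pd2 f i j z = fderiv ℝ (fderiv ℝ f) z V V := by
      simp only [pd2_eq hf]
      rw [hV]
      simp only [map_sum, map_smul, _root_.sum_apply, _root_.smul_apply,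
        smul_eq_mul, Finset.mul_sum]
      rw [Finset.sum_comm]
      refine Finset.sum_congr rfl fun i _ => Finset.sum_congr rfl fun j _ => ?_
      ring
    rw [h1]
    have hline : ∀ t : ℝ, HasDerivAt (fun t : ℝ => z + t • V) V t := by
      intro t
      simpa using ((hasDerivAt_id t).smul_const V).const_add z
    have hct : Tendsto (fun t : ℝ => z + t • V) (𝓝 0) (𝓝 z) := by
      have := (hline 0).continuousAt.tendsto
      simpa using this
    have hev : ∀ᶠ x in 𝓝 z, DifferentiableAt ℝ f x := by
      have := hf.eventually (by simp)
      filter_upwards [this] with x hx using hx.differentiableAt (by norm_num)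
    have hder : deriv (fun t : ℝ => f (z + t • V)) =ᶠ[𝓝 0] fun t => fderiv ℝ f (z + t • V) V := by
      filter_upwards [hct.eventually hev] with t ht
      exact (ht.hasFDerivAt.comp_hasDerivAt t (hline t)).deriv
    have h2 : deriv (deriv (fun t : ℝ => f (z + t • V))) 0 = fderiv ℝ (fderiv ℝ f) z V V := by
      rw [hder.deriv_eq]
      have hd' : HasFDerivAt (fderiv ℝ f) (fderiv ℝ (fderiv ℝ f) z) (z + (0:ℝ) • V) := by
        simpa using hd.hasFDerivAt
      have := (hd'.comp_hasDerivAt (0:ℝ) (hline 0))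
      exact (this.clm_apply (hasDerivAt_const (0:ℝ) V)).deriv.trans (by simp)
    rw [← h2]
    apply second_test
    · have := hct.eventually hz
      filter_upwards [this] with t ht
      simpa using ht
    · have : ContinuousAt f (z + (0:ℝ) • V) := by simpa using hf.continuousAt
      exact ContinuousAt.comp (f := fun t : ℝ => z + t • V) this (hline 0).continuousAt

/-- barrier -/
noncomputable def bar {m : ℕ} (α R : ℝ) (y x : EuclideanSpace ℝ (Fin m)) : ℝ :=
  Real.exp (α * (R ^ 2 - ‖x - y‖ ^ 2)) - 1

lemma bar_contDiff {m : ℕ} (α R : ℝ) (y : EuclideanSpace ℝ (Fin m)) : ContDiff ℝ 2 (bar α R y) := by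
  unfold bar
  have : ContDiff ℝ 2 (fun x : EuclideanSpace ℝ (Fin m) => ‖x - y‖ ^ 2) :=
    (contDiff_id.sub contDiff_const).norm_sq ℝ
  fun_prop

lemma bar_hasFDeriv {m : ℕ} (α R : ℝ) (y x : EuclideanSpace ℝ (Fin m)) :
    HasFDerivAt (bar α R y) ((-2 * α * Real.exp (α * (R ^ 2 - ‖x - y‖ ^ 2))) • innerSL ℝ (x - y)) x := by
  have h1 : HasFDerivAt (fun x => ‖x - y‖ ^ 2) (2 • (innerSL ℝ (x - y))) x := by
    have := ((hasFDerivAt_id x).sub_const y).norm_sq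
    simpa using this
  have h2 := ((h1.const_sub (R ^ 2)).const_mul α).exp.sub_const 1
  refine h2.congr_fderiv ?_
  ext v
  simp
  ring

lemma pd_bar {m : ℕ} (α R : ℝ) (y x : EuclideanSpace ℝ (Fin m)) (j : Fin m) :
    pd (bar α R y) j x = -2 * α * Real.exp (α * (R ^ 2 - ‖x - y‖ ^ 2)) * (x j - y j) := by
  unfold pd
  rw [(bar_hasFDeriv α R y x).fderiv]
  simp [EuclideanSpace.inner_single_right]

lemma pd2_bar {m : ℕ} (α R : ℝ) (y x : EuclideanSpace ℝ (Fin m)) (i j : Fin m) :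
    pd2 (bar α R y) i j x = Real.exp (α * (R ^ 2 - ‖x - y‖ ^ 2)) *
      (4 * α ^ 2 * ((x i - y i) * (x j - y j)) - 2 * α * (if i = j then 1 else 0)) := by
  unfold pd2
  have : (fun z => pd (bar α R y) j z) = fun z => (-2 * α) * ((bar α R y z + 1) * (z j - y j)) := by
    ext z; rw [pd_bar]; unfold bar; ring
  rw [this]
  unfold pd
  have h1 : HasFDerivAt (fun z : EuclideanSpace ℝ (Fin m) => z j - y j)
      (EuclideanSpace.proj j : EuclideanSpace ℝ (Fin m) →L[ℝ] ℝ) x :=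
    ((EuclideanSpace.proj j : EuclideanSpace ℝ (Fin m) →L[ℝ] ℝ).hasFDerivAt).sub_const _
  have h2 := ((((bar_hasFDeriv α R y x).add_const 1).mul h1).const_mul (-2 * α))
  refine (congrArg (fun l => l (EuclideanSpace.single i 1)) h2.fderiv).trans ?_
  simp [EuclideanSpace.inner_single_right, bar, Pi.single_apply, eq_comm]
  ring_nf
  try grind

lemma pd_sub_bar {m : ℕ} {u : EuclideanSpace ℝ (Fin m) → ℝ} {z : EuclideanSpace ℝ (Fin m)}
    (hu : ContDiffAt ℝ 2 u z) (ε α R : ℝ) (y : EuclideanSpace ℝ (Fin m)) (j : Fin m) :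
    pd (fun x => u x - ε * bar α R y x) j z = pd u j z - ε * pd (bar α R y) j z := by
  unfold pd
  have h1 := (hu.differentiableAt (by norm_num)).hasFDerivAt.sub
    ((bar_hasFDeriv α R y z).const_mul ε)
  refine (congrArg (fun l => l (EuclideanSpace.single j 1)) h1.fderiv).trans ?_
  rw [(bar_hasFDeriv α R y z).fderiv]
  simp

lemma pd2_sub_bar {m : ℕ} {u : EuclideanSpace ℝ (Fin m) → ℝ} {z : EuclideanSpace ℝ (Fin m)}
    (hu : ContDiffAt ℝ 2 u z) (ε α R : ℝ) (y : EuclideanSpace ℝ (Fin m)) (i j : Fin m) :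
    pd2 (fun x => u x - ε * bar α R y x) i j z = pd2 u i j z - ε * pd2 (bar α R y) i j z := by
  have hev : (fun x => pd (fun x => u x - ε * bar α R y x) j x) =ᶠ[𝓝 z]
      fun x => pd u j x - ε * pd (bar α R y) j x := by
    filter_upwards [hu.eventually (by simp)] with x hx
    exact pd_sub_bar hx ε α R y j
  have hd : ∀ f : EuclideanSpace ℝ (Fin m) → ℝ, ContDiffAt ℝ 2 f z →
      DifferentiableAt ℝ (fun x => pd f j x) z := by
    intro f hf
    have hd : DifferentiableAt ℝ (fderiv ℝ f) z :=
      (hf.fderiv_right (m := 1) (by norm_num)).differentiableAt (by norm_num)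
    unfold pd
    fun_prop
  unfold pd2
  have h1 := (hd u hu).hasFDerivAt.sub
    ((hd _ (bar_contDiff α R y).contDiffAt).hasFDerivAt.const_mul ε)
  unfold pd at hev h1 ⊢
  rw [hev.fderiv_eq]
  refine (congrArg (fun l => l (EuclideanSpace.single i 1)) h1.fderiv).trans ?_
  simp

set_option maxHeartbeats 1000000 in
lemma touch (n : ℕ)
    (A : Fin (n + 1) → Fin (n + 1) → EuclideanSpace ℝ (Fin (n + 1)) → ℝ)
    (b : Fin n → EuclideanSpace ℝ (Fin (n + 1)) → ℝ)
    (c : EuclideanSpace ℝ (Fin (n + 1)) → ℝ)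
    (hA : ∀ i j, Continuous (A i j)) (hb : ∀ i, Continuous (b i)) (hc : Continuous c)
    (hc0 : ∀ x, 0 ≤ c x)
    (hell : ∀ (x : EuclideanSpace ℝ (Fin (n + 1))) (v : Fin (n + 1) → ℝ), v ≠ 0 →
      0 < ∑ i, ∑ j, A i j x * v i * v j)
    (u : EuclideanSpace ℝ (Fin (n + 1)) → ℝ)
    (hu2 : ContDiffOn ℝ 2 u (Metric.ball (0 : EuclideanSpace ℝ (Fin (n + 1))) 1))
    (hsuper : ∀ x ∈ Metric.ball (0 : EuclideanSpace ℝ (Fin (n + 1))) 1,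
      x (Fin.last n) ≠ 0 →
      (∑ i, ∑ j, A i j x * pd2 u i j x) + (∑ i : Fin n, b i x * pd u i.castSucc x) +
        (c x / x (Fin.last n)) * pd u (Fin.last n) x ≤ 0)
    (x₀ y : EuclideanSpace ℝ (Fin (n + 1))) (R : ℝ) (hR : 0 < R) (hx₀ : ‖x₀ - y‖ = R)
    (hsub : Metric.closedBall y R ⊆ Metric.ball 0 1)
    (hmin : ∀ x ∈ Metric.ball (0 : EuclideanSpace ℝ (Fin (n + 1))) 1, u x₀ ≤ u x)
    (hlt : ∀ x ∈ Metric.closedBall y R, x ≠ x₀ → u x₀ < u x)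
    (hside : ∀ x ∈ Metric.closedBall y R, x ≠ x₀ → 0 < y (Fin.last n) * x (Fin.last n)) :
    False := by
  have hCD : ∀ x ∈ Metric.closedBall y R, ContDiffAt ℝ 2 u x := fun x hx =>
    hu2.contDiffAt (Metric.isOpen_ball.mem_nhds (hsub hx))
  have hx₀y : x₀ ∈ Metric.closedBall y R := by simp [dist_eq_norm, hx₀]
  -- the annulus
  set D : Set (EuclideanSpace ℝ (Fin (n + 1))) := Metric.closedBall y R \ Metric.ball y (R / 2)
    with hD
  have hDc : IsCompact D := (isCompact_closedBall y R).diff Metric.isOpen_ball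
  have hx₀D : x₀ ∈ D := by
    refine ⟨hx₀y, ?_⟩
    simp [dist_eq_norm, hx₀]; linarith
  -- lower bound for ellipticity
  obtain ⟨z₁, hz₁, hF⟩ := hDc.exists_isMinOn ⟨x₀, hx₀D⟩
    (f := fun x => ∑ i, ∑ j, A i j x * (x i - y i) * (x j - y j)) (by fun_prop)
  set lam := ∑ i, ∑ j, A i j z₁ * (z₁ i - y i) * (z₁ j - y j) with hlam
  have hlam0 : 0 < lam := by
    apply hell z₁ (fun i => z₁ i - y i)
    intro h
    apply hz₁.2
    have : z₁ = y := by
      ext i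
      have := congrFun h i
      simp at this
      linarith
    rw [this]; simp [hR]
  obtain ⟨z₂, hz₂, hG⟩ := hDc.exists_isMinOn ⟨x₀, hx₀D⟩
    (f := fun x => -(∑ i, A i i x) - (∑ i : Fin n, b i x * (x i.castSucc - y i.castSucc)) - c x)
    (by fun_prop)
  set K := -(∑ i, A i i z₂) - (∑ i : Fin n, b i z₂ * (z₂ i.castSucc - y i.castSucc)) - c z₂ with hK
  obtain ⟨α, hα, hαK⟩ : ∃ α : ℝ, 0 < α ∧ 0 < 2 * α * lam + K := by
    refine ⟨(|K| + 1) / lam, by positivity, ?_⟩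
    have : (|K| + 1) / lam * lam = |K| + 1 := by field_simp
    have h2 := neg_abs_le K
    have h3 := abs_nonneg K
    nlinarith
  -- gap
  obtain ⟨z₃, hz₃, hgap⟩ := (isCompact_closedBall y (R / 2)).exists_isMinOn
    (f := u) ⟨y, by simp; linarith⟩
    (fun x hx => (hCD x (Metric.closedBall_subset_closedBall (by linarith) hx)).continuousAt.continuousWithinAt)
  have hδ : u x₀ < u z₃ := by
    apply hlt _ (Metric.closedBall_subset_closedBall (by linarith) hz₃)
    rintro rfl
    simp [dist_eq_norm, hx₀] at hz₃
    linarith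
  set E := Real.exp (α * R ^ 2) with hE
  have hE0 : 0 < E := Real.exp_pos _
  set ε := (u z₃ - u x₀) / E with hε
  have hε0 : 0 < ε := div_pos (by linarith) hE0
  have hεE : ε * E = u z₃ - u x₀ := by rw [hε]; field_simp
  set V : EuclideanSpace ℝ (Fin (n + 1)) → ℝ := fun x => u x - ε * bar α R y x with hV
  have hVCD : ∀ x ∈ Metric.closedBall y R, ContDiffAt ℝ 2 V x := fun x hx =>
    (hCD x hx).sub (contDiffAt_const.mul (bar_contDiff α R y).contDiffAt)
  obtain ⟨z, hz, hzmin⟩ := hDc.exists_isMinOn ⟨x₀, hx₀D⟩ (f := V)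
    (fun x hx => (hVCD x hx.1).continuousAt.continuousWithinAt)
  have hVm : u x₀ ≤ V z := by
    by_contra! hneg
    have hzn1 : ‖z - y‖ < R := by
      rcases lt_or_eq_of_le (by simpa [dist_eq_norm] using hz.1 : ‖z - y‖ ≤ R) with h | h
      · exact h
      · exfalso
        have : V z = u z := by simp [hV, bar, h]
        have := hmin z (hsub hz.1)
        linarith
    have hzn2 : R / 2 < ‖z - y‖ := by
      have h0 : R / 2 ≤ ‖z - y‖ := by simpa [dist_eq_norm] using hz.2
      rcases lt_or_eq_of_le h0 with h | h
      · exact h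
      · exfalso
        have h1 : u z₃ ≤ u z := hgap (by simp [dist_eq_norm, ← h])
        have h2 : bar α R y z ≤ E := by
          unfold bar
          have : Real.exp (α * (R ^ 2 - ‖z - y‖ ^ 2)) ≤ E := by
            apply Real.exp_le_exp.2
            nlinarith [sq_nonneg ‖z - y‖]
          linarith
        have h3 := mul_le_mul_of_nonneg_left h2 hε0.le
        simp only [hV] at hneg
        linarith
    have hloc : IsLocalMin V z := by
      have h1 : Metric.ball y R ∈ 𝓝 z := Metric.isOpen_ball.mem_nhds (by simpa [dist_eq_norm] using hzn1)
      have h2 : (Metric.closedBall y (R / 2))ᶜ ∈ 𝓝 z :=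
        Metric.isClosed_closedBall.isOpen_compl.mem_nhds (by simpa [dist_eq_norm] using hzn2)
      filter_upwards [h1, h2] with x hx hx'
      exact hzmin ⟨Metric.ball_subset_closedBall hx,
        fun h => hx' (Metric.ball_subset_closedBall h)⟩
    have hzne : z ≠ x₀ := by rintro rfl; linarith
    have hs := hside z hz.1 hzne
    have hze : z (Fin.last n) ≠ 0 := by intro h; rw [h] at hs; simp at hs
    have hL := hsuper z (hsub hz.1) hze
    have hM := min_test (hVCD z hz.1) hloc (fun i j => A i j z) (hell z)
    have hpd : ∀ j, pd u j z = ε * pd (bar α R y) j z := by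
      intro j
      have h1 := pd_sub_bar (hCD z hz.1) ε α R y j
      have h2 : pd V j z = 0 := by unfold pd; rw [hloc.fderiv_eq_zero]; simp
      rw [h2] at h1
      linarith
    set e := Real.exp (α * (R ^ 2 - ‖z - y‖ ^ 2)) with he
    have he0 : 0 < e := Real.exp_pos _
    have hFz : lam ≤ ∑ i, ∑ j, A i j z * (z i - y i) * (z j - y j) := hF hz
    have hGz : K ≤ -(∑ i, A i i z) - (∑ i : Fin n, b i z * (z i.castSucc - y i.castSucc)) - c z := hG hz
    have s1 : ∑ i, ∑ j, A i j z * pd2 V i j z = (∑ i, ∑ j, A i j z * pd2 u i j z)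
        - ε * (e * (4 * α ^ 2 * (∑ i, ∑ j, A i j z * (z i - y i) * (z j - y j))
          - 2 * α * ∑ i, A i i z)) := by
      have t1 : ∀ i, ∑ j, A i j z * pd2 V i j z = (∑ j, A i j z * pd2 u i j z)
        - ε * (e * (4 * α ^ 2 * (∑ j, A i j z * (z i - y i) * (z j - y j))
          - 2 * α * A i i z)) := by
        intro i
        have : A i i z = ∑ j, A i j z * (if i = j then 1 else 0) := by simp
        rw [this]
        simp only [Finset.mul_sum, ← Finset.sum_sub_distrib]
        refine Finset.sum_congr rfl fun j _ => ?_
        rw [hV, pd2_sub_bar (hCD z hz.1), pd2_bar]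
        ring
      simp only [t1, Finset.sum_sub_distrib, ← Finset.mul_sum]
    have s2 : ∑ i : Fin n, b i z * pd u i.castSucc z =
        ε * (e * (-2 * α * ∑ i : Fin n, b i z * (z i.castSucc - y i.castSucc))) := by
      simp only [Finset.mul_sum]
      refine Finset.sum_congr rfl fun j _ => ?_
      rw [hpd, pd_bar]; ring
    have s3 : c z / z (Fin.last n) * pd u (Fin.last n) z =
        ε * (e * (2 * α * (c z * (y (Fin.last n) / z (Fin.last n)) - c z))) := by
      rw [hpd, pd_bar]; field_simp; ring
    have s4 : 0 ≤ c z * (y (Fin.last n) / z (Fin.last n)) := by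
      apply mul_nonneg (hc0 z)
      have : y (Fin.last n) / z (Fin.last n) = y (Fin.last n) * z (Fin.last n) / z (Fin.last n) ^ 2 := by
        field_simp
      rw [this]; positivity
    rw [s1] at hM
    rw [s2, s3] at hL
    set F := ∑ i, ∑ j, A i j z * (z i - y i) * (z j - y j)
    set T := ∑ i, A i i z
    set S := ∑ i : Fin n, b i z * (z i.castSucc - y i.castSucc)
    set Q := c z * (y (Fin.last n) / z (Fin.last n))
    have hfin : ε * (e * (2 * α * (2 * α * F + (-T - S - c z) + Q))) ≤ 0 := by nlinarith
    have : 0 < 2 * α * F + (-T - S - c z) + Q := by nlinarith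
    have : 0 < ε * (e * (2 * α * (2 * α * F + (-T - S - c z) + Q))) := by positivity
    linarith
  -- derivative at x₀
  have hloc0 : IsLocalMin u x₀ := by
    filter_upwards [Metric.isOpen_ball.mem_nhds (hsub hx₀y)] with x hx using hmin x hx
  have hder : HasDerivAt (fun t : ℝ => V (x₀ + t • (y - x₀))) (-(ε * (2 * α * R ^ 2))) 0 := by
    have hl : HasDerivAt (fun t : ℝ => x₀ + t • (y - x₀)) (y - x₀) 0 := by
      simpa using ((hasDerivAt_id (0:ℝ)).smul_const (y - x₀)).const_add x₀
    have h1 : HasFDerivAt V (fderiv ℝ u x₀ - ε • ((-2 * α * Real.exp (α * (R ^ 2 - ‖x₀ - y‖ ^ 2))) • innerSL ℝ (x₀ - y))) (x₀ + (0:ℝ) • (y - x₀)) := by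
      simp only [zero_smul, add_zero]
      exact ((hCD x₀ hx₀y).differentiableAt (by norm_num)).hasFDerivAt.sub
        ((bar_hasFDeriv α R y x₀).const_mul ε)
    have h2 := h1.comp_hasDerivAt (0:ℝ) hl
    refine h2.congr_deriv ?_
    rw [hloc0.fderiv_eq_zero, hx₀]
    have : y - x₀ = -(x₀ - y) := by abel
    rw [this]
    simp only [_root_.sub_apply, _root_.smul_apply, innerSL_apply_apply, inner_neg_right,
      real_inner_self_eq_norm_sq, hx₀]
    simp
  have hneg : -(ε * (2 * α * R ^ 2)) < 0 := by
    have : 0 < ε * (2 * α * R ^ 2) := by positivity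
    linarith
  have hev := hder.tendsto_slope_zero_right.eventually (eventually_lt_nhds hneg)
  have h1 : ∀ᶠ t : ℝ in 𝓝[>] 0, t < 1 / 2 :=
    nhdsWithin_le_nhds (eventually_lt_nhds (by norm_num))
  obtain ⟨t, ht, ht2, ht0⟩ := (hev.and (h1.and self_mem_nhdsWithin)).exists
  have ht0 : 0 < t := ht0
  have hVx₀ : V x₀ = u x₀ := by simp [hV, bar, hx₀]
  have hmem : x₀ + t • (y - x₀) ∈ D := by
    have e1 : x₀ + t • (y - x₀) - y = (1 - t) • (x₀ - y) := by
      module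
    have e2 : ‖x₀ + t • (y - x₀) - y‖ = (1 - t) * R := by
      rw [e1, norm_smul, hx₀, Real.norm_of_nonneg (by linarith)]
    constructor
    · rw [Metric.mem_closedBall, dist_eq_norm, e2]; nlinarith
    · rw [Metric.mem_ball, dist_eq_norm, e2]; nlinarith
  have h3 : V z ≤ V (x₀ + t • (y - x₀)) := hzmin hmem
  simp only [zero_add, zero_smul, add_zero, smul_eq_mul, hVx₀] at ht
  have : 0 ≤ t⁻¹ * (V (x₀ + t • (y - x₀)) - u x₀) :=
    mul_nonneg (inv_nonneg.2 ht0.le) (by linarith)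
  linarith

lemma midball {m : ℕ} {x x₀ y : EuclideanSpace ℝ (Fin m)} {R : ℝ} (hR : 0 < R) (h0 : ‖x₀ - y‖ = R)
    (hx : ‖x - midpoint ℝ y x₀‖ ≤ R / 2) (hne : x ≠ x₀) : ‖x - y‖ < R := by
  have e0 : midpoint ℝ y x₀ = (1/2 : ℝ) • (y + x₀) := by
    rw [midpoint_eq_smul_add]; norm_num
  set p := (1/2 : ℝ) • (x₀ - y) with hp
  set q := x - midpoint ℝ y x₀ with hq
  have hpn : ‖p‖ = R / 2 := by rw [hp, norm_smul, h0]; norm_num; ring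
  have e1 : x - y = p + q := by rw [hp, hq, e0]; module
  have e2 : x₀ - x = p - q := by rw [hp, hq, e0]; module
  have h1 : 0 < ‖x₀ - x‖ := norm_pos_iff.2 (sub_ne_zero.2 hne.symm)
  have h2 := parallelogram_law_with_norm ℝ p q
  rw [← e1, ← e2, hpn] at h2
  have h3 := norm_nonneg (x - y)
  have h4 := norm_nonneg q
  by_contra! h
  nlinarith

/-- Lemma 2.1: strong minimum principle for the singular/degenerate operator
`L u = Σ a_{ij} ∂_{ij} u + Σ b_i ∂_i u + (a(x)/x_{n+1}) ∂_{n+1} u` in the unit ball. -/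
theorem strong_minimum_principle (n : ℕ)
    (A : Fin (n + 1) → Fin (n + 1) → EuclideanSpace ℝ (Fin (n + 1)) → ℝ)
    (b : Fin n → EuclideanSpace ℝ (Fin (n + 1)) → ℝ)
    (c : EuclideanSpace ℝ (Fin (n + 1)) → ℝ)
    (hA : ∀ i j, Continuous (A i j)) (hb : ∀ i, Continuous (b i)) (hc : Continuous c)
    (hc0 : ∀ x, 0 ≤ c x)
    (hell : ∀ (x : EuclideanSpace ℝ (Fin (n + 1))) (v : Fin (n + 1) → ℝ), v ≠ 0 →
      0 < ∑ i, ∑ j, A i j x * v i * v j)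
    (u : EuclideanSpace ℝ (Fin (n + 1)) → ℝ)
    (hu2 : ContDiffOn ℝ 2 u (Metric.ball (0 : EuclideanSpace ℝ (Fin (n + 1))) 1))
    (huc : ContinuousOn u (Metric.closedBall (0 : EuclideanSpace ℝ (Fin (n + 1))) 1))
    (hbdry : ∀ x ∈ Metric.ball (0 : EuclideanSpace ℝ (Fin (n + 1))) 1,
      x (Fin.last n) = 0 → pd u (Fin.last n) x = 0)
    (hsuper : ∀ x ∈ Metric.ball (0 : EuclideanSpace ℝ (Fin (n + 1))) 1,
      x (Fin.last n) ≠ 0 →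
      (∑ i, ∑ j, A i j x * pd2 u i j x) + (∑ i : Fin n, b i x * pd u i.castSucc x) +
        (c x / x (Fin.last n)) * pd u (Fin.last n) x ≤ 0) :
    (∀ x ∈ Metric.ball (0 : EuclideanSpace ℝ (Fin (n + 1))) 1,
        ∀ y ∈ Metric.ball (0 : EuclideanSpace ℝ (Fin (n + 1))) 1, u x = u y) ∨
    ¬ ∃ x₀ ∈ Metric.ball (0 : EuclideanSpace ℝ (Fin (n + 1))) 1,
        ∀ x ∈ Metric.closedBall (0 : EuclideanSpace ℝ (Fin (n + 1))) 1, u x₀ ≤ u x := by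
  by_cases hex : ∃ x₀ ∈ Metric.ball (0 : EuclideanSpace ℝ (Fin (n + 1))) 1,
        ∀ x ∈ Metric.closedBall (0 : EuclideanSpace ℝ (Fin (n + 1))) 1, u x₀ ≤ u x
  swap
  · exact Or.inr hex
  left
  obtain ⟨x₀, hx₀, hmin'⟩ := hex
  obtain ⟨m, hm⟩ : ∃ m, m = u x₀ := ⟨_, rfl⟩
  have hmin : ∀ x ∈ Metric.ball (0 : EuclideanSpace ℝ (Fin (n + 1))) 1, m ≤ u x := fun x hx =>
    hm ▸ hmin' x (Metric.ball_subset_closedBall hx)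
  have hcont : ContinuousOn u (Metric.ball (0 : EuclideanSpace ℝ (Fin (n + 1))) 1) := hu2.continuousOn
  have hkey : ∀ (s : ℝ) (y : EuclideanSpace ℝ (Fin (n + 1))) (R : ℝ) (x₁ : EuclideanSpace ℝ (Fin (n + 1))),
      0 < R → Metric.ball y R ⊆ Metric.ball 0 1 → (∀ x ∈ Metric.ball y R, 0 < s * x (Fin.last n)) →
      x₁ ∈ Metric.ball (0 : EuclideanSpace ℝ (Fin (n + 1))) 1 → ‖x₁ - y‖ = R → u x₁ = m →
      ∃ x ∈ Metric.ball y R, u x = m := by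
    intro s y R x₁ hR hsub hs hx₁ hx₁y hum
    by_contra! hno
    have hb' : ∀ x ∈ Metric.closedBall (midpoint ℝ y x₁) (R / 2), x ≠ x₁ → x ∈ Metric.ball y R := by
      intro x hx hne
      rw [Metric.mem_ball, dist_eq_norm]
      rw [Metric.mem_closedBall, dist_eq_norm] at hx
      exact midball hR hx₁y hx hne
    have hmid : ‖x₁ - midpoint ℝ y x₁‖ = R / 2 := by
      rw [← hx₁y, ← dist_eq_norm, ← dist_eq_norm, dist_right_midpoint]
      rw [dist_comm y x₁]; norm_num; ring
    have hmidne : midpoint ℝ y x₁ ≠ x₁ := by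
      intro h; rw [h] at hmid; simp at hmid; linarith
    have hymid : midpoint ℝ y x₁ ∈ Metric.ball y R := hb' _ (by simp; linarith) hmidne
    refine touch n A b c hA hb hc hc0 hell u hu2 hsuper x₁ (midpoint ℝ y x₁) (R / 2) (by linarith)
      hmid ?_ ?_ ?_ ?_
    · intro x hx
      by_cases h : x = x₁
      · rw [h]; exact hx₁
      · exact hsub (hb' x hx h)
    · intro x hx; rw [hum]; exact hmin x hx
    · intro x hx hne
      rw [hum]
      exact lt_of_le_of_ne (hmin x (hsub (hb' x hx hne))) (Ne.symm (hno x (hb' x hx hne)))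
    · intro x hx hne
      have h1 := hs _ (hb' x hx hne)
      have h2 := hs _ hymid
      have h3 := mul_pos h1 h2
      have h4 : 0 ≤ s ^ 2 := sq_nonneg s
      by_contra! h5
      nlinarith
  set e : EuclideanSpace ℝ (Fin (n + 1)) := EuclideanSpace.single (Fin.last n) 1 with he
  have hcoord : Continuous fun x : EuclideanSpace ℝ (Fin (n + 1)) => x (Fin.last n) := by fun_prop
  -- step 1
  have hstep1 : ∀ s : ℝ, (∃ z ∈ Metric.ball (0 : EuclideanSpace ℝ (Fin (n + 1))) 1,
      0 < s * z (Fin.last n) ∧ u z = m) →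
      ∀ z ∈ Metric.ball (0 : EuclideanSpace ℝ (Fin (n + 1))) 1, 0 < s * z (Fin.last n) → u z = m := by
    intro s ⟨z₀, hz₀, hz₀s, hz₀m⟩ w hw hws
    by_contra hwm
    set S : Set (EuclideanSpace ℝ (Fin (n + 1))) := Metric.ball 0 1 ∩ {x | 0 < s * x (Fin.last n)} with hS
    have hSo : IsOpen S := Metric.isOpen_ball.inter (isOpen_lt continuous_const (by fun_prop))
    have hSc : Convex ℝ S := by
      refine (convex_ball 0 1).inter ?_
      intro a ha b hb p q hp hq hpq
      simp only [Set.mem_ofPred_eq, PiLp.add_apply, PiLp.smul_apply, smul_eq_mul] at *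
      rcases hp.lt_or_eq with hp | hp
      · nlinarith [mul_pos hp ha, mul_nonneg hq hb.le]
      · have : q = 1 := by linarith
        subst this; subst hp; simpa using hb
    have hSP : IsPreconnected S := hSc.isPreconnected
    have hQ : IsOpen (S ∩ u ⁻¹' {m}ᶜ) :=
      (hcont.mono Set.inter_subset_left).isOpen_inter_preimage hSo isOpen_compl_singleton
    have hP : IsOpen (S ∩ u ⁻¹' {m}) := by
      rw [Metric.isOpen_iff]
      rintro z ⟨hzS, hzm⟩
      obtain ⟨r, hr, hrS⟩ := Metric.isOpen_iff.1 hSo z hzS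
      refine ⟨r / 4, by linarith, fun y hy => ?_⟩
      have hyS : y ∈ S := hrS (Metric.ball_subset_ball (by linarith) hy)
      refine ⟨hyS, ?_⟩
      by_contra hym
      have hcs : Metric.closedBall z (r / 2) ⊆ S :=
        (Metric.closedBall_subset_ball (by linarith)).trans hrS
      have hNc : IsCompact (Metric.closedBall z (r / 2) ∩ u ⁻¹' {m}) := by
        refine (isCompact_closedBall z (r/2)).of_isClosed_subset ?_ Set.inter_subset_left
        exact (hcont.mono (hcs.trans Set.inter_subset_left)).preimage_isClosed_of_isClosed
          Metric.isClosed_closedBall isClosed_singleton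
      obtain ⟨x₁, hx₁, hx₁min⟩ := hNc.exists_isMinOn
        ⟨z, by simp; linarith, hzm⟩ (f := fun x => dist x y) (by fun_prop)
      have hd1 : dist x₁ y ≤ dist z y := hx₁min ⟨by simp; linarith, hzm⟩
      have hd2 : dist y z < r / 4 := hy
      have hd3 : dist z y < r / 4 := by rwa [dist_comm]
      have hd0 : 0 < dist x₁ y := by
        apply dist_pos.2
        rintro rfl
        exact hym hx₁.2
      have hbs : Metric.ball y (dist x₁ y) ⊆ Metric.closedBall z (r / 2) := by
        intro x hx
        have h1 : dist x y < dist x₁ y := hx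
        have h2 := dist_triangle x y z
        rw [Metric.mem_closedBall]; linarith
      obtain ⟨x, hx, hxm⟩ := hkey s y (dist x₁ y) x₁ hd0
        (fun x hx => (hcs (hbs hx)).1) (fun x hx => (hcs (hbs hx)).2) (hcs hx₁.1).1
        (dist_eq_norm _ _).symm hx₁.2
      have h1 : dist x₁ y ≤ dist x y := hx₁min ⟨hbs hx, hxm⟩
      have h2 : dist x y < dist x₁ y := hx
      linarith
    obtain ⟨x, _, hx1, hx2⟩ := hSP _ _ hP hQ
      (fun x hx => by
        by_cases h : u x = m
        · exact Or.inl ⟨hx, h⟩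
        · exact Or.inr ⟨hx, h⟩)
      ⟨z₀, ⟨hz₀, hz₀s⟩, ⟨hz₀, hz₀s⟩, hz₀m⟩ ⟨w, ⟨hw, hws⟩, ⟨hw, hws⟩, hwm⟩
    exact hx2.2 hx1.2
  -- step 2
  have hstep2 : ∀ s : ℝ, s ^ 2 = 1 → ∀ z ∈ Metric.ball (0 : EuclideanSpace ℝ (Fin (n + 1))) 1,
      z (Fin.last n) = 0 → u z = m → ∃ z ∈ Metric.ball (0 : EuclideanSpace ℝ (Fin (n + 1))) 1,
      0 < s * z (Fin.last n) ∧ u z = m := by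
    intro s hs z hz hz0 hzm
    have hz1 : ‖z‖ < 1 := by simpa using hz
    have hs1 : |s| = 1 := by
      rcases (by simpa using hs : s = 1 ∨ s = -1) with h | h <;> simp [h]
    set ρ := (1 - ‖z‖) / 2 with hρ
    have hρ0 : 0 < ρ := by rw [hρ]; linarith
    have hse : ‖(s * ρ) • e‖ = ρ := by
      rw [norm_smul, he]; simp [hs1, abs_of_pos hρ0]
    have hbs : Metric.ball (z + (s * ρ) • e) ρ ⊆ Metric.ball 0 1 := by
      intro x hx
      rw [Metric.mem_ball, dist_eq_norm] at hx
      have h1 : x = (x - (z + (s * ρ) • e)) + (z + (s * ρ) • e) := by abel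
      have h2 := norm_add_le (x - (z + (s * ρ) • e)) (z + (s * ρ) • e)
      have h3 := norm_add_le z ((s * ρ) • e)
      rw [← h1] at h2
      rw [mem_ball_zero_iff]
      linarith
    have hpos : ∀ x ∈ Metric.ball (z + (s * ρ) • e) ρ, 0 < s * x (Fin.last n) := by
      intro x hx
      rw [Metric.mem_ball, dist_eq_norm] at hx
      have h1 := (PiLp.norm_apply_le (x - (z + (s * ρ) • e)) (Fin.last n)).trans_lt hx
      have h2 : (x - (z + (s * ρ) • e)) (Fin.last n) = x (Fin.last n) - s * ρ := by
        simp [he, hz0]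
      rw [h2, Real.norm_eq_abs] at h1
      have h3 : |s * (x (Fin.last n) - s * ρ)| < ρ := by rw [abs_mul, hs1, one_mul]; exact h1
      have h4 := (abs_lt.1 h3).1
      nlinarith
    obtain ⟨x, hx, hxm⟩ := hkey s (z + (s * ρ) • e) ρ z hρ0 hbs hpos hz
      (by rw [sub_add_cancel_left, norm_neg, hse]) hzm
    exact ⟨x, hbs hx, hpos x hx, hxm⟩
  -- step 3
  have hstep3 : ∀ s : ℝ, s ^ 2 = 1 → (∀ z ∈ Metric.ball (0 : EuclideanSpace ℝ (Fin (n + 1))) 1,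
      0 < s * z (Fin.last n) → u z = m) → ∀ w ∈ Metric.ball (0 : EuclideanSpace ℝ (Fin (n + 1))) 1,
      0 ≤ s * w (Fin.last n) → u w = m := by
    intro s hs hS w hw hws
    have hl : Tendsto (fun t : ℝ => w + (t * s) • e) (𝓝[>] 0) (𝓝 w) := by
      have : Continuous (fun t : ℝ => w + (t * s) • e) := by fun_prop
      have := this.tendsto 0
      simp only [zero_mul, zero_smul, add_zero] at this
      exact this.mono_left nhdsWithin_le_nhds
    have hwn := Metric.isOpen_ball.mem_nhds hw
    have h1 := (hcont.continuousAt hwn).tendsto.comp hl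
    have h2 : Tendsto (u ∘ fun t : ℝ => w + (t * s) • e) (𝓝[>] 0) (𝓝 m) := by
      apply tendsto_const_nhds.congr'
      filter_upwards [hl.eventually hwn, self_mem_nhdsWithin] with t ht ht0
      have ht0 : 0 < t := ht0
      refine (hS _ ht ?_).symm
      simp [he]
      nlinarith
    exact tendsto_nhds_unique h1 h2
  have h0 : ∃ z ∈ Metric.ball (0 : EuclideanSpace ℝ (Fin (n + 1))) 1, z (Fin.last n) = 0 ∧ u z = m := by
    rcases lt_trichotomy (x₀ (Fin.last n)) 0 with h | h | h
    · exact ⟨0, by simp, by simp, hstep3 (-1) (by norm_num)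
        (hstep1 (-1) ⟨x₀, hx₀, by linarith, hm.symm⟩) 0 (by simp) (by simp)⟩
    · exact ⟨x₀, hx₀, h, hm.symm⟩
    · exact ⟨0, by simp, by simp, hstep3 1 (by norm_num)
        (hstep1 1 ⟨x₀, hx₀, by linarith, hm.symm⟩) 0 (by simp) (by simp)⟩
  obtain ⟨z, hz, hz0, hzm⟩ := h0
  have hall : ∀ w ∈ Metric.ball (0 : EuclideanSpace ℝ (Fin (n + 1))) 1, u w = m := by
    intro w hw
    rcases le_total 0 (w (Fin.last n)) with h | h
    · exact hstep3 1 (by norm_num) (hstep1 1 (hstep2 1 (by norm_num) z hz hz0 hzm)) w hw (by linarith)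
    · exact hstep3 (-1) (by norm_num) (hstep1 (-1) (hstep2 (-1) (by norm_num) z hz hz0 hzm)) w hw
        (by linarith)
  intro x hx y hy
  rw [hall x hx, hall y hy]
end

section
/- Let L(u) = Σ_{i,j=1}^{n+1} a_{ij}(x)∂_{ij}u + Σ_{i=1}^{n} b_i(x)∂_iu + (a(x)/x_{n+1})∂_{n+1}u, where a_{ij}, b_i, a ∈ C(ℝ^{n+1}), a(x) ≥ 0 everywhere, and (a_{ij}(x)) is positive definite. Suppose u ∈ C²(B₁) ∩ C¹(closure B₁) satisfies ∂_{n+1}u(x',0) = 0 whenever (x',0) ∈ B₁, and −L(u) ≥ 0 at every point of B₁ with x_{n+1} ≠ 0. If u attains its minimum over closure B₁ at a point x⁰ ∈ ∂B₁, then either u is constant on closure B₁ or the outward normal derivative of u at x⁰ is strictly negative, i.e., −∂u/∂n(x⁰) > 0 where n = x⁰ is the outward unit normal to ∂B₁ at x⁰. -/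
open Filter Topology Metric Set

lemma hbp_snd_nonneg (g g1 : ℝ → ℝ) (g2 : ℝ) (h1 : ∀ᶠ t in 𝓝 (0:ℝ), HasDerivAt g (g1 t) t)
    (h2 : HasDerivAt g1 g2 0) (hm : IsLocalMin g 0) : 0 ≤ g2 := by
  by_contra! hneg
  have hd : deriv g =ᶠ[𝓝 0] g1 := h1.mono fun t ht => ht.deriv
  have hdd : deriv (deriv g) 0 = g2 := by rw [hd.deriv_eq]; exact h2.deriv
  have h0 : deriv g 0 = 0 := hm.deriv_eq_zero
  have hmax := isLocalMax_of_deriv_deriv_neg (f := g) (x₀ := 0) (by rw [hdd]; exact hneg) h0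
    h1.self_of_nhds.continuousAt
  have hc : g =ᶠ[𝓝 0] fun _ => g 0 := by
    filter_upwards [hm, hmax] with t a b using le_antisymm b a
  have : deriv (deriv g) 0 = 0 := by
    rw [hc.deriv.deriv_eq]; simp
  linarith

lemma hbp_trace {m : ℕ} (A : Fin m → Fin m → ℝ) (M : Fin m → Fin m → ℝ)
    (hA : ∀ v : Fin m → ℝ, 0 ≤ ∑ i, ∑ j, A i j * v i * v j)
    (hs : ∀ i j, M i j = M j i) (hM : ∀ v : Fin m → ℝ, 0 ≤ ∑ i, ∑ j, M i j * v i * v j) :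
    0 ≤ ∑ i, ∑ j, A i j * M i j := by
  have hP : (Matrix.of M).PosSemidef := by
    apply Matrix.PosSemidef.of_dotProduct_mulVec_nonneg
    · ext i j; simp [hs i j]
    · intro v
      refine (hM v).trans_eq ?_
      simp only [dotProduct, Matrix.mulVec, Finset.mul_sum]
      refine Finset.sum_congr rfl fun i _ => Finset.sum_congr rfl fun j _ => ?_
      simp; ring
  obtain ⟨k, B, hB⟩ := Matrix.posSemidef_iff_eq_sum_vecMulVec.mp hP
  have hB' : ∀ i j, M i j = ∑ l, B l i * B l j := by
    intro i j
    have := congrFun (congrFun hB i) j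
    simpa [Matrix.sum_apply, Matrix.vecMulVec_apply] using this
  have : ∑ i, ∑ j, A i j * M i j = ∑ l, ∑ i, ∑ j, A i j * B l i * B l j := by
    simp only [hB', Finset.mul_sum]
    rw [Finset.sum_comm]
    simp_rw [Finset.sum_comm (s := (Finset.univ : Finset (Fin m))) (t := (Finset.univ : Finset (Fin k)))]
    refine Finset.sum_congr rfl fun l _ => ?_
    rw [Finset.sum_comm]
    simp only [mul_assoc]
  rw [this]
  exact Finset.sum_nonneg fun l _ => hA _

lemma hbp_fderiv_eq {m : ℕ} (u : EuclideanSpace ℝ (Fin m) → ℝ) (x v : EuclideanSpace ℝ (Fin m)) :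
    fderiv ℝ u x v = ∑ j, v j * pd u j x := by
  have hv : v = ∑ j, v j • EuclideanSpace.single j (1:ℝ) := by
    ext i; simp [Finset.sum_apply, Pi.single_apply]
  conv_lhs => rw [hv]
  simp [pd]

lemma hbp_line {m : ℕ} (p v : EuclideanSpace ℝ (Fin m)) (t : ℝ) :
    HasDerivAt (fun t : ℝ => p + t • v) v t := by
  simpa using ((hasDerivAt_id t).smul_const v).const_add p

lemma hbp_line_tendsto {m : ℕ} (p v : EuclideanSpace ℝ (Fin m)) :
    Tendsto (fun t : ℝ => p + t • v) (𝓝 0) (𝓝 p) := by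
  have := (hbp_line p v 0).continuousAt.tendsto
  simpa using this

lemma hbp_pd_contDiff {m : ℕ} {u : EuclideanSpace ℝ (Fin m) → ℝ} {p : EuclideanSpace ℝ (Fin m)}
    (hu : ContDiffAt ℝ 2 u p) (j : Fin m) : ContDiffAt ℝ 1 (fun z => pd u j z) p := by
  have := hu.fderiv_right (m := 1) (by norm_num)
  exact this.clm_apply contDiffAt_const

lemma hbp_pd2_cont {m : ℕ} {u : EuclideanSpace ℝ (Fin m) → ℝ} {p : EuclideanSpace ℝ (Fin m)}
    (hu : ContDiffAt ℝ 2 u p) (i j : Fin m) : ContinuousAt (fun z => pd2 u i j z) p := by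
  have := (hbp_pd_contDiff hu j).fderiv_right (m := 0) (by norm_num)
  exact this.continuousAt.clm_apply continuousAt_const

lemma hbp_pd2_symm {m : ℕ} {u : EuclideanSpace ℝ (Fin m) → ℝ} {p : EuclideanSpace ℝ (Fin m)}
    (hu : ContDiffAt ℝ 2 u p) (i j : Fin m) : pd2 u i j p = pd2 u j i p := by
  have hs := hu.isSymmSndFDerivAt (by simp)
  have hd : DifferentiableAt ℝ (fderiv ℝ u) p :=
    (hu.fderiv_right (m := 1) (by norm_num)).differentiableAt (by norm_num)
  have key : ∀ i j, pd2 u i j p =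
      fderiv ℝ (fderiv ℝ u) p (EuclideanSpace.single i 1) (EuclideanSpace.single j 1) := by
    intro i j
    unfold pd2
    simp only [pd]
    rw [fderiv_clm_apply hd (differentiableAt_const _)]
    simp
  rw [key, key]; exact hs _ _

lemma hbp_line1 {m : ℕ} {u : EuclideanSpace ℝ (Fin m) → ℝ} {p : EuclideanSpace ℝ (Fin m)}
    (hu : ContDiffAt ℝ 2 u p) (v : EuclideanSpace ℝ (Fin m)) :
    ∀ᶠ t in 𝓝 (0:ℝ), HasDerivAt (fun t : ℝ => u (p + t • v)) (∑ j, v j * pd u j (p + t • v)) t := by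
  have h1 : ∀ᶠ x in 𝓝 p, ContDiffAt ℝ 2 u x := hu.eventually (by simp)
  filter_upwards [(hbp_line_tendsto p v).eventually h1] with t ht
  rw [← hbp_fderiv_eq]
  exact (ht.differentiableAt (by norm_num)).hasFDerivAt.comp_hasDerivAt t (hbp_line p v t)

lemma hbp_pdline {m : ℕ} {u : EuclideanSpace ℝ (Fin m) → ℝ} {p : EuclideanSpace ℝ (Fin m)}
    (hu : ContDiffAt ℝ 2 u p) (v : EuclideanSpace ℝ (Fin m)) (j : Fin m) :
    HasDerivAt (fun t : ℝ => pd u j (p + t • v)) (∑ i, v i * pd2 u i j p) 0 := by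
  have h := ((hbp_pd_contDiff hu j).differentiableAt (by norm_num)).hasFDerivAt
  have h' : HasFDerivAt (fun z => pd u j z) (fderiv ℝ (fun z => pd u j z) p) (p + (0:ℝ) • v) := by
    simpa using h
  have := h'.comp_hasDerivAt (0:ℝ) (hbp_line p v 0)
  rw [hbp_fderiv_eq] at this
  exact this

lemma hbp_line2 {m : ℕ} {u : EuclideanSpace ℝ (Fin m) → ℝ} {p : EuclideanSpace ℝ (Fin m)}
    (hu : ContDiffAt ℝ 2 u p) (v : EuclideanSpace ℝ (Fin m)) :
    HasDerivAt (fun t : ℝ => ∑ j, v j * pd u j (p + t • v))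
      (∑ i, ∑ j, pd2 u i j p * v i * v j) 0 := by
  have := HasDerivAt.fun_sum (u := Finset.univ) fun j _ => (hbp_pdline hu v j).const_mul (v j)
  refine this.congr_deriv ?_
  symm
  rw [Finset.sum_comm]
  simp only [Finset.mul_sum]
  refine Finset.sum_congr rfl fun i _ => Finset.sum_congr rfl fun j _ => ?_
  ring

lemma hbp_exp_line {m : ℕ} (α : ℝ) (p y v : EuclideanSpace ℝ (Fin m)) (t : ℝ) :
    Real.exp (-α * ‖p + t • v - y‖ ^ 2) =
      Real.exp (-α * (‖p - y‖ ^ 2 + 2 * t * (∑ i, (p - y) i * v i) + t ^ 2 * ∑ i, v i * v i)) := by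
  congr 2
  simp only [EuclideanSpace.norm_sq_eq, Finset.mul_sum, ← Finset.sum_add_distrib]
  refine Finset.sum_congr rfl fun i _ => ?_
  simp; ring

lemma hbp_exp1 (α s r w t : ℝ) :
    HasDerivAt (fun t => Real.exp (-α * (s + 2 * t * r + t ^ 2 * w)))
     (Real.exp (-α * (s + 2 * t * r + t ^ 2 * w)) * (-α * (2 * r + 2 * t * w))) t := by
  apply HasDerivAt.exp
  apply HasDerivAt.const_mul
  have h1 : HasDerivAt (fun t : ℝ => 2 * t * r) (2 * 1 * r) t :=
    ((hasDerivAt_id t).const_mul 2).mul_const r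
  have h2 : HasDerivAt (fun t : ℝ => t ^ 2 * w) (2 * t * w) t := by
    simpa using (hasDerivAt_pow 2 t).mul_const w
  refine (((hasDerivAt_const t s).add h1).add h2).congr_deriv ?_
  ring

lemma hbp_exp2 (α s r w : ℝ) :
    HasDerivAt (fun t => Real.exp (-α * (s + 2 * t * r + t ^ 2 * w)) * (-α * (2 * r + 2 * t * w)))
     (Real.exp (-α * s) * (4 * α ^ 2 * r ^ 2 - 2 * α * w)) 0 := by
  have h1 := hbp_exp1 α s r w 0
  have h2 : HasDerivAt (fun t : ℝ => -α * (2 * r + 2 * t * w)) (-α * (2 * 1 * w)) 0 := by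
    apply HasDerivAt.const_mul
    exact (((hasDerivAt_id (0:ℝ)).const_mul 2).mul_const w).const_add _
  refine (h1.mul h2).congr_deriv ?_
  simp; ring

/-- first and second order conditions at a touching point -/
lemma hbp_touch {m : ℕ} {u : EuclideanSpace ℝ (Fin m) → ℝ} {p y : EuclideanSpace ℝ (Fin m)}
    (hu : ContDiffAt ℝ 2 u p) (α ε : ℝ)
    (hmin : IsLocalMin (fun x => u x - ε * Real.exp (-α * ‖x - y‖ ^ 2)) p) :
    (∀ i, pd u i p = ε * Real.exp (-α * ‖p - y‖ ^ 2) * (-2 * α * (p - y) i)) ∧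
    (∀ A : Fin m → Fin m → ℝ, (∀ v : Fin m → ℝ, 0 ≤ ∑ i, ∑ j, A i j * v i * v j) →
      ε * Real.exp (-α * ‖p - y‖ ^ 2) *
        (4 * α ^ 2 * (∑ i, ∑ j, A i j * (p - y) i * (p - y) j) - 2 * α * ∑ i, A i i)
        ≤ ∑ i, ∑ j, A i j * pd2 u i j p) := by
  set e := Real.exp (-α * ‖p - y‖ ^ 2) with he
  have hlm : ∀ v : EuclideanSpace ℝ (Fin m), IsLocalMin (fun t : ℝ => u (p + t • v) - ε *
      Real.exp (-α * (‖p - y‖ ^ 2 + 2 * t * (∑ i, (p - y) i * v i) + t ^ 2 * ∑ i, v i * v i))) 0 := by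
    intro v
    have h1 := (hbp_line_tendsto p v).eventually hmin
    filter_upwards [h1] with t ht
    rw [← hbp_exp_line, ← hbp_exp_line]
    simpa using ht
  constructor
  · intro i
    have hd := ((hbp_line1 hu (EuclideanSpace.single i 1)).self_of_nhds.sub
      ((hbp_exp1 α (‖p - y‖ ^ 2) (∑ k, (p - y) k * (EuclideanSpace.single i (1:ℝ)) k)
        (∑ k, (EuclideanSpace.single i (1:ℝ)) k * (EuclideanSpace.single i (1:ℝ)) k) 0).const_mul ε))
    have h0 := (hlm _).hasDerivAt_eq_zero hd
    simp at h0
    simp only [he, neg_mul, PiLp.sub_apply] at *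
    linarith
  · intro A hA
    have hq : ∀ v : Fin m → ℝ, 0 ≤ ∑ i, ∑ j, (pd2 u i j p - ε * e * (4 * α ^ 2 * ((p - y) i * (p - y) j)
        - 2 * α * if i = j then 1 else 0)) * v i * v j := by
      intro v
      set V : EuclideanSpace ℝ (Fin m) := WithLp.toLp 2 v with hV
      have := hbp_snd_nonneg _ _ _ ((hbp_line1 hu V).mono fun t ht => ht.sub
        ((hbp_exp1 α (‖p - y‖ ^ 2) (∑ k, (p - y) k * V k) (∑ k, V k * V k) t).const_mul ε))
        ((hbp_line2 hu V).sub ((hbp_exp2 α (‖p - y‖ ^ 2) (∑ k, (p - y) k * V k)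
          (∑ k, V k * V k)).const_mul ε)) (hlm V)
      refine this.trans_eq ?_
      have e1 : (∑ k, (p - y) k * V k) ^ 2 = ∑ i, ∑ j, ((p - y) i * (p - y) j) * v i * v j := by
        rw [sq, Finset.sum_mul_sum]
        refine Finset.sum_congr rfl fun i _ => Finset.sum_congr rfl fun j _ => ?_
        simp [hV]; ring
      have e2 : (∑ k, V k * V k) = ∑ i, ∑ j, (if i = j then (1:ℝ) else 0) * v i * v j := by
        simp [hV]
      rw [e1, e2]
      simp only [Finset.mul_sum, ← Finset.sum_sub_distrib]
      refine Finset.sum_congr rfl fun i _ => Finset.sum_congr rfl fun j _ => ?_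
      simp only [hV, he]; ring
    have := hbp_trace A _ hA (fun i j => by
      rw [hbp_pd2_symm hu i j, mul_comm ((p - y) i)]; simp only [eq_comm]) hq
    have e3 : ∑ i, A i i = ∑ i, ∑ j, A i j * (if i = j then (1:ℝ) else 0) := by simp
    rw [e3, ← sub_nonneg]
    refine this.trans_eq ?_
    simp only [Finset.mul_sum, ← Finset.sum_sub_distrib]
    refine Finset.sum_congr rfl fun i _ => Finset.sum_congr rfl fun j _ => ?_
    ring

structure HbpData (n : ℕ)
    (A : Fin (n + 1) → Fin (n + 1) → EuclideanSpace ℝ (Fin (n + 1)) → ℝ)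
    (b : Fin n → EuclideanSpace ℝ (Fin (n + 1)) → ℝ)
    (c : EuclideanSpace ℝ (Fin (n + 1)) → ℝ)
    (u : EuclideanSpace ℝ (Fin (n + 1)) → ℝ) : Prop where
  hA : ∀ i j, Continuous (A i j)
  hb : ∀ i, Continuous (b i)
  hc : Continuous c
  hc0 : ∀ x, 0 ≤ c x
  hell : ∀ (x : EuclideanSpace ℝ (Fin (n + 1))) (v : Fin (n + 1) → ℝ), v ≠ 0 →
      0 < ∑ i, ∑ j, A i j x * v i * v j
  hu2 : ContDiffOn ℝ 2 u (Metric.ball (0 : EuclideanSpace ℝ (Fin (n + 1))) 1)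
  hu1 : ContDiffOn ℝ 1 u (Metric.closedBall (0 : EuclideanSpace ℝ (Fin (n + 1))) 1)
  hbdry : ∀ x ∈ Metric.ball (0 : EuclideanSpace ℝ (Fin (n + 1))) 1,
      x (Fin.last n) = 0 → pd u (Fin.last n) x = 0
  hsuper : ∀ x ∈ Metric.ball (0 : EuclideanSpace ℝ (Fin (n + 1))) 1,
      x (Fin.last n) ≠ 0 →
      (∑ i, ∑ j, A i j x * pd2 u i j x) + (∑ i : Fin n, b i x * pd u i.castSucc x) +
        (c x / x (Fin.last n)) * pd u (Fin.last n) x ≤ 0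

section
variable {n : ℕ} {A : Fin (n + 1) → Fin (n + 1) → EuclideanSpace ℝ (Fin (n + 1)) → ℝ}
    {b : Fin n → EuclideanSpace ℝ (Fin (n + 1)) → ℝ}
    {c : EuclideanSpace ℝ (Fin (n + 1)) → ℝ}
    {u : EuclideanSpace ℝ (Fin (n + 1)) → ℝ}

lemma HbpData.cda (D : HbpData n A b c u) {p : EuclideanSpace ℝ (Fin (n + 1))}
    (hp : p ∈ ball (0 : EuclideanSpace ℝ (Fin (n + 1))) 1) : ContDiffAt ℝ 2 u p :=
  D.hu2.contDiffAt (isOpen_ball.mem_nhds hp)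

lemma HbpData.limit (D : HbpData n A b c u) {p : EuclideanSpace ℝ (Fin (n + 1))}
    (hp : p ∈ ball (0 : EuclideanSpace ℝ (Fin (n + 1))) 1) (hp0 : p (Fin.last n) = 0) :
    (∑ i, ∑ j, A i j p * pd2 u i j p) + (∑ i : Fin n, b i p * pd u i.castSucc p) +
        c p * pd2 u (Fin.last n) (Fin.last n) p ≤ 0 := by
  have hu := D.cda hp
  set e : EuclideanSpace ℝ (Fin (n + 1)) := EuclideanSpace.single (Fin.last n) 1 with he
  have hl : Tendsto (fun t : ℝ => p + t • e) (𝓝[≠] 0) (𝓝 p) :=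
    (hbp_line_tendsto p e).mono_left nhdsWithin_le_nhds
  have hd : HasDerivAt (fun t : ℝ => pd u (Fin.last n) (p + t • e))
      (pd2 u (Fin.last n) (Fin.last n) p) 0 := by
    refine (hbp_pdline hu e (Fin.last n)).congr_deriv ?_
    simp [he]
  have hs := hasDerivAt_iff_tendsto_slope_zero.mp hd
  have hT : Tendsto (fun t : ℝ => (∑ i, ∑ j, A i j (p + t • e) * pd2 u i j (p + t • e)) +
      (∑ i : Fin n, b i (p + t • e) * pd u i.castSucc (p + t • e)) + c (p + t • e) *
        (t⁻¹ • (pd u (Fin.last n) (p + (0 + t) • e) - pd u (Fin.last n) (p + (0:ℝ) • e))))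
      (𝓝[≠] 0) (𝓝 ((∑ i, ∑ j, A i j p * pd2 u i j p) +
        (∑ i : Fin n, b i p * pd u i.castSucc p) + c p * pd2 u (Fin.last n) (Fin.last n) p)) := by
    refine (Tendsto.add ?_ ?_).add ?_
    · refine tendsto_finsetSum _ fun i _ => tendsto_finsetSum _ fun j _ => ?_
      exact (((D.hA i j).tendsto p).comp hl).mul ((hbp_pd2_cont hu i j).tendsto.comp hl)
    · refine tendsto_finsetSum _ fun i _ => ?_
      exact (((D.hb i).tendsto p).comp hl).mul
        ((hbp_pd_contDiff hu i.castSucc).continuousAt.tendsto.comp hl)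
    · exact ((D.hc.tendsto p).comp hl).mul hs
  refine le_of_tendsto hT ?_
  filter_upwards [hl.eventually (isOpen_ball.mem_nhds hp), self_mem_nhdsWithin] with t ht ht0
  have hN : (p + t • e) (Fin.last n) = t := by simp [he, hp0]
  have := D.hsuper _ ht (by rw [hN]; exact ht0)
  rw [hN] at this
  have h0 := D.hbdry p hp hp0
  refine le_trans (le_of_eq ?_) this
  congr 1
  simp only [zero_add, zero_smul, add_zero, h0, sub_zero, smul_eq_mul]
  ring

lemma HbpData.consts (D : HbpData n A b c u) : ∃ l > 0, ∃ C > 0,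
    ∀ x ∈ closedBall (0 : EuclideanSpace ℝ (Fin (n + 1))) 1,
      (∀ v : EuclideanSpace ℝ (Fin (n + 1)), l * ‖v‖ ^ 2 ≤ ∑ i, ∑ j, A i j x * v i * v j) ∧
      (∑ i, A i i x) + (∑ i, |b i x|) + c x ≤ C := by
  have hK : IsCompact ((closedBall (0 : EuclideanSpace ℝ (Fin (n + 1))) 1) ×ˢ
      (sphere (0 : EuclideanSpace ℝ (Fin (n + 1))) 1)) :=
    (isCompact_closedBall _ _).prod (isCompact_sphere _ _)
  have hne : ((closedBall (0 : EuclideanSpace ℝ (Fin (n + 1))) 1) ×ˢ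
      (sphere (0 : EuclideanSpace ℝ (Fin (n + 1))) 1)).Nonempty := by
    refine ⟨(0, EuclideanSpace.single (Fin.last n) 1), ?_⟩
    simp
  have hF : Continuous (fun q : EuclideanSpace ℝ (Fin (n + 1)) × EuclideanSpace ℝ (Fin (n + 1)) =>
      ∑ i, ∑ j, A i j q.1 * q.2 i * q.2 j) := by
    have := D.hA
    fun_prop
  obtain ⟨q, hq, hmin⟩ := hK.exists_isMinOn hne hF.continuousOn
  have hG : Continuous (fun x => (∑ i, A i i x) + (∑ i, |b i x|) + c x) := by
    have := D.hA
    have := D.hb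
    have := D.hc
    fun_prop
  obtain ⟨C, hC⟩ := (isCompact_closedBall (0 : EuclideanSpace ℝ (Fin (n + 1))) 1).bddAbove_image
    hG.continuousOn
  refine ⟨_, D.hell q.1 q.2 ?_, max C 1, by positivity, fun x hx => ⟨fun v => ?_, ?_⟩⟩
  · intro h
    have : q.2 = 0 := by ext i; exact congrFun h i
    have h2 := hq.2
    simp [this] at h2
  · by_cases hv : v = 0
    · simp [hv]
    have hv' : 0 < ‖v‖ := norm_pos_iff.mpr hv
    have := hmin (show (x, ‖v‖⁻¹ • v) ∈ _ from ⟨hx, by simp [norm_smul, hv'.ne']⟩)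
    simp only [mem_ofPred_eq] at this
    have h2 := mul_le_mul_of_nonneg_right this (sq_nonneg ‖v‖)
    refine h2.trans_eq ?_
    simp only [Finset.sum_mul]
    refine Finset.sum_congr rfl fun i _ => Finset.sum_congr rfl fun j _ => ?_
    simp
    field_simp
  · exact (hC (mem_image_of_mem _ hx)).trans (le_max_left _ _)

lemma HbpData.barrier (D : HbpData n A b c u) {p y : EuclideanSpace ℝ (Fin (n + 1))}
    (hp : p ∈ ball (0 : EuclideanSpace ℝ (Fin (n + 1))) 1) {l C α ε r : ℝ}
    (hl : 0 < l) (hα : 0 < α) (hε : 0 < ε) (hr : 0 < r)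
    (h1 : ∀ v : EuclideanSpace ℝ (Fin (n + 1)), l * ‖v‖ ^ 2 ≤ ∑ i, ∑ j, A i j p * v i * v j)
    (h2 : (∑ i, A i i p) + (∑ i, |b i p|) + c p ≤ C)
    (hαC : C < 2 * α * (l * r ^ 2)) (hr1 : r ≤ ‖p - y‖) (hr2 : ‖p - y‖ ≤ 1)
    (hy : y (Fin.last n) = 0 ∨ 0 < y (Fin.last n) * p (Fin.last n))
    (hmin : IsLocalMin (fun x => u x - ε * Real.exp (-α * ‖x - y‖ ^ 2)) p) : False := by
  obtain ⟨hg, hh⟩ := hbp_touch (D.cda hp) α ε hmin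
  have hA0 : ∀ v : Fin (n+1) → ℝ, 0 ≤ ∑ i, ∑ j, A i j p * v i * v j := by
    intro v
    by_cases hv : v = 0
    · simp [hv]
    · exact (D.hell p v hv).le
  have hS := hh (fun i j => A i j p) hA0
  set K := ε * Real.exp (-α * ‖p - y‖ ^ 2) with hK
  have hKpos : 0 < K := by positivity
  have hQ : l * r ^ 2 ≤ ∑ i, ∑ j, A i j p * (p - y) i * (p - y) j :=
    le_trans (by gcongr) (h1 (p - y))
  have hB : -(2 * α * K) * ∑ i, |b i p| ≤ ∑ i : Fin n, b i p * pd u i.castSucc p := by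
    rw [Finset.mul_sum]
    refine Finset.sum_le_sum fun i _ => ?_
    rw [hg]
    have h3 : |(p - y) i.castSucc| ≤ 1 := (PiLp.norm_apply_le (p - y) i.castSucc).trans hr2
    have h4 : b i p * (p - y) i.castSucc ≤ |b i p| := by
      calc b i p * (p - y) i.castSucc ≤ |b i p * (p - y) i.castSucc| := le_abs_self _
        _ = |b i p| * |(p - y) i.castSucc| := abs_mul _ _
        _ ≤ |b i p| := mul_le_of_le_one_right (abs_nonneg _) h3
    have := mul_le_mul_of_nonneg_left h4 (show 0 ≤ 2 * α * K by positivity)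
    linarith
  have hfin : (∑ i, ∑ j, A i j p * pd2 u i j p) + (∑ i : Fin n, b i p * pd u i.castSucc p)
      - 2 * α * K * c p ≤ 0 := by
    by_cases hp0 : p (Fin.last n) = 0
    · have hlim := D.limit hp hp0
      have h5 := hh (fun i j => if i = Fin.last n then (if j = Fin.last n then 1 else 0) else 0) (by
        intro v; simp [mul_self_nonneg])
      simp at h5
      have h6 : -(2 * α * K) ≤ pd2 u (Fin.last n) (Fin.last n) p := by
        refine le_trans ?_ h5
        have : 0 ≤ K * (4 * α ^ 2 * ((p (Fin.last n) - y (Fin.last n)) *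
          (p (Fin.last n) - y (Fin.last n)))) := by
          have := mul_self_nonneg (p (Fin.last n) - y (Fin.last n))
          positivity
        linarith
      have := mul_le_mul_of_nonneg_left h6 (D.hc0 p)
      linarith
    · have hs := D.hsuper p hp hp0
      rw [hg (Fin.last n)] at hs
      have hθ : 0 ≤ y (Fin.last n) / p (Fin.last n) := by
        rcases hy with h | h
        · simp [h]
        · rw [← mul_div_mul_right _ _ hp0]
          exact div_nonneg h.le (mul_self_nonneg _)
      have h7 : c p / p (Fin.last n) * (K * (-2 * α * (p - y) (Fin.last n))) =
          - 2 * α * K * c p + 2 * α * K * c p * (y (Fin.last n) / p (Fin.last n)) := by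
        simp only [PiLp.sub_apply]
        field_simp
        ring
      have := D.hc0 p
      have h8 : 0 ≤ 2 * α * K * c p * (y (Fin.last n) / p (Fin.last n)) := by positivity
      linarith
  have h9 : 0 < K * (2 * α) * (2 * α * (l * r ^ 2) - C) := by
    have : 0 < 2 * α * (l * r ^ 2) - C := by linarith
    positivity
  have h10 := mul_le_mul_of_nonneg_left h2 (show 0 ≤ 2 * α * K by positivity)
  have h11 := mul_le_mul_of_nonneg_left hQ (show 0 ≤ K * (4 * α ^ 2) by positivity)
  nlinarith

lemma HbpData.hopf (D : HbpData n A b c u) {y z : EuclideanSpace ℝ (Fin (n + 1))} {R m : ℝ}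
    (hR : 0 < R) (hR1 : R ≤ 1)
    (hsub : closedBall y R ⊆ closedBall (0 : EuclideanSpace ℝ (Fin (n + 1))) 1)
    (hsub' : ball y R ⊆ ball (0 : EuclideanSpace ℝ (Fin (n + 1))) 1)
    (hy : ∀ p ∈ ball y R, y (Fin.last n) = 0 ∨ 0 < y (Fin.last n) * p (Fin.last n))
    (hm : ∀ x ∈ closedBall (0 : EuclideanSpace ℝ (Fin (n + 1))) 1, m ≤ u x)
    (hgt : ∀ x ∈ ball y R, m < u x) (hz : dist z y = R) (huz : u z = m) :
    fderivWithin ℝ u (closedBall (0 : EuclideanSpace ℝ (Fin (n + 1))) 1) z (z - y) < 0 := by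
  obtain ⟨l, hl, C, hC, hlC⟩ := D.consts
  have huc : ContinuousOn u (closedBall (0 : EuclideanSpace ℝ (Fin (n + 1))) 1) := D.hu1.continuousOn
  have hnz : ‖z - y‖ = R := by rw [← dist_eq_norm]; exact hz
  -- the path towards the center
  have hpath : ∀ t : ℝ, 0 ≤ t → t ≤ 1 → dist (z + t • (y - z)) y = (1 - t) * R := by
    intro t ht0 ht1
    rw [dist_eq_norm, show z + t • (y - z) - y = (1 - t) • (z - y) by module, norm_smul, hnz,
      Real.norm_of_nonneg (by linarith)]
  have hSs : sphere y (R / 2) ⊆ ball y R := by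
    intro x hx
    rw [mem_sphere] at hx
    rw [mem_ball, hx]; linarith
  obtain ⟨q, hq, hqmin⟩ := (isCompact_sphere y (R / 2)).exists_isMinOn
    ⟨z + (1 / 2 : ℝ) • (y - z), by
      rw [mem_sphere, hpath _ (by norm_num) (by norm_num)]; ring⟩
    (huc.mono (hSs.trans (ball_subset_closedBall.trans hsub)))
  set δ := u q - m with hδ
  have hδpos : 0 < δ := sub_pos.mpr (hgt q (hSs hq))
  set α := (C + 1) / (2 * (l * (R / 2) ^ 2)) with hα
  have hαpos : 0 < α := by positivity
  have hαC : C < 2 * α * (l * (R / 2) ^ 2) := by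
    have : 2 * α * (l * (R / 2) ^ 2) = C + 1 := by rw [hα]; field_simp
    linarith
  have hKc : IsCompact (closedBall y R \ ball y (R / 2)) :=
    (isCompact_closedBall y R).diff isOpen_ball
  have hwc : ContinuousOn (fun x => u x - δ * Real.exp (-α * ‖x - y‖ ^ 2))
      (closedBall y R \ ball y (R / 2)) := by
    refine ContinuousOn.sub (huc.mono (sdiff_subset.trans hsub)) ?_
    exact Continuous.continuousOn (by fun_prop)
  have hzK : z ∈ closedBall y R \ ball y (R / 2) := by
    refine ⟨by rw [mem_closedBall, hz], ?_⟩
    rw [mem_ball, hz]; linarith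
  obtain ⟨p, hp, hpmin⟩ := hKc.exists_isMinOn ⟨z, hzK⟩ hwc
  have hcomp : m - δ * Real.exp (-α * R ^ 2) ≤ u p - δ * Real.exp (-α * ‖p - y‖ ^ 2) := by
    have hp1 : dist p y ≤ R := hp.1
    have hp2 : R / 2 ≤ dist p y := by simpa using hp.2
    rcases eq_or_lt_of_le hp1 with h | h
    · rw [dist_eq_norm] at h
      rw [h]
      linarith [hm p (hsub hp.1)]
    rcases eq_or_lt_of_le hp2 with h' | h'
    · have h3 : u q ≤ u p := hqmin (show p ∈ sphere y (R / 2) from h'.symm)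
      have h4 : Real.exp (-α * ‖p - y‖ ^ 2) ≤ 1 := by
        rw [Real.exp_le_one_iff]
        have : 0 ≤ α * ‖p - y‖ ^ 2 := by positivity
        linarith
      have h5 : 0 < Real.exp (-α * R ^ 2) := Real.exp_pos _
      nlinarith
    · exfalso
      have hpb : p ∈ ball y R := h
      refine D.barrier (hsub' hpb) hl hαpos hδpos (half_pos hR) (hlC p (hsub hp.1)).1
        (hlC p (hsub hp.1)).2 hαC (y := y) ?_ ?_ (hy p hpb) ?_
      · rw [← dist_eq_norm]; exact hp2
      · rw [← dist_eq_norm]; exact hp1.trans hR1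
      · refine hpmin.isLocalMin ?_
        have ho : IsOpen (ball y R \ closedBall y (R / 2)) := isOpen_ball.sdiff isClosed_closedBall
        refine mem_of_superset (ho.mem_nhds ⟨hpb, by simpa using h'⟩) ?_
        exact sdiff_subset_sdiff ball_subset_closedBall ball_subset_closedBall
  set κ := δ * Real.exp (-α * R ^ 2) * (α * R ^ 2) with hκ
  have hκpos : 0 < κ := by positivity
  have hlow : ∀ t ∈ Ioc (0:ℝ) (1 / 2), u z + κ * t ≤ u (z + t • (y - z)) := by
    intro t ht
    have hd := hpath t ht.1.le (by linarith [ht.2])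
    have hxK : z + t • (y - z) ∈ closedBall y R \ ball y (R / 2) := by
      rw [Set.mem_sdiff, mem_closedBall, mem_ball, hd]
      constructor
      · nlinarith [ht.1]
      · nlinarith [ht.2]
    have h6 := hcomp.trans (hpmin hxK)
    simp only at h6
    rw [← dist_eq_norm, hd] at h6
    have h7 : Real.exp (-α * ((1 - t) * R) ^ 2) =
        Real.exp (-α * R ^ 2) * Real.exp (α * R ^ 2 * (2 * t - t ^ 2)) := by
      rw [← Real.exp_add]; congr 1; ring
    have h8 : α * R ^ 2 * t + 1 ≤ Real.exp (α * R ^ 2 * (2 * t - t ^ 2)) := by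
      refine le_trans ?_ (Real.add_one_le_exp _)
      have : t ≤ 2 * t - t ^ 2 := by nlinarith [ht.1, ht.2]
      gcongr
    have h9 := mul_le_mul_of_nonneg_left h8 (show 0 ≤ δ * Real.exp (-α * R ^ 2) by positivity)
    rw [h7] at h6
    rw [huz, hκ]
    linarith
  have hfd : HasFDerivWithinAt u
      (fderivWithin ℝ u (closedBall (0 : EuclideanSpace ℝ (Fin (n + 1))) 1) z)
      (closedBall (0 : EuclideanSpace ℝ (Fin (n + 1))) 1) (z + (0:ℝ) • (y - z)) := by
    have := (D.hu1.differentiableOn (by norm_num) z (hsub hzK.1)).hasFDerivWithinAt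
    simpa using this
  have hder := hfd.comp_hasDerivWithinAt (0:ℝ) (s := Ioc (0:ℝ) (1 / 2))
    (hbp_line z (y - z) 0).hasDerivWithinAt (by
      intro t ht
      apply hsub
      rw [mem_closedBall, hpath t ht.1.le (by linarith [ht.2])]
      nlinarith [ht.1])
  rw [hasDerivWithinAt_iff_tendsto_slope' (by simp)] at hder
  have hne : (𝓝[Ioc (0:ℝ) (1 / 2)] 0).NeBot := by
    rw [nhdsWithin_Ioc_eq_nhdsGT (by norm_num)]; infer_instance
  have hge := ge_of_tendsto hder (b := κ) (by
    filter_upwards [self_mem_nhdsWithin] with t ht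
    have := hlow t ht
    rw [slope_def_field]
    simp only [Function.comp, zero_smul, add_zero, sub_zero]
    rw [le_div_iff₀ ht.1]
    linarith)
  have : fderivWithin ℝ u (closedBall (0 : EuclideanSpace ℝ (Fin (n + 1))) 1) z (z - y) =
    - fderivWithin ℝ u (closedBall (0 : EuclideanSpace ℝ (Fin (n + 1))) 1) z (y - z) := by
    rw [← map_neg, neg_sub]
  rw [this]
  linarith

lemma HbpData.nohopf (D : HbpData n A b c u) {y z : EuclideanSpace ℝ (Fin (n + 1))} {R m : ℝ}
    (hR : 0 < R) (hR1 : R ≤ 1)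
    (hsub : closedBall y R ⊆ closedBall (0 : EuclideanSpace ℝ (Fin (n + 1))) 1)
    (hsub' : ball y R ⊆ ball (0 : EuclideanSpace ℝ (Fin (n + 1))) 1)
    (hy : ∀ p ∈ ball y R, 0 < y (Fin.last n) * p (Fin.last n))
    (hm : ∀ x ∈ closedBall (0 : EuclideanSpace ℝ (Fin (n + 1))) 1, m ≤ u x)
    (hgt : ∀ x ∈ ball y R, u x ≠ m) (hz : dist z y = R) (huz : u z = m)
    (hzb : z ∈ ball (0 : EuclideanSpace ℝ (Fin (n + 1))) 1) : False := by
  have h := D.hopf hR hR1 hsub hsub' (fun p hp => Or.inr (hy p hp)) hm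
    (fun x hx => lt_of_le_of_ne (hm x (ball_subset_closedBall (hsub' hx))) (hgt x hx).symm) hz huz
  have hn : closedBall (0 : EuclideanSpace ℝ (Fin (n + 1))) 1 ∈ 𝓝 z :=
    mem_of_superset (isOpen_ball.mem_nhds hzb) ball_subset_closedBall
  have hmin : IsLocalMin u z := by
    filter_upwards [hn] with x hx
    rw [huz]; exact hm x hx
  rw [fderivWithin_of_mem_nhds hn, hmin.fderiv_eq_zero] at h
  simp at h

def hbpHalf (n : ℕ) (σ : ℝ) : Set (EuclideanSpace ℝ (Fin (n + 1))) :=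
  ball 0 1 ∩ {x | 0 < σ * x (Fin.last n)}

lemma hbpHalf_open (σ : ℝ) : IsOpen (hbpHalf n σ) :=
  isOpen_ball.inter (isOpen_lt continuous_const (by fun_prop))

lemma hbpHalf_conv (σ : ℝ) : Convex ℝ (hbpHalf n σ) := by
  refine (convex_ball _ _).inter ?_
  intro x hx y hy a b ha hb hab
  simp only [mem_ofPred_eq] at hx hy ⊢
  simp only [PiLp.add_apply, PiLp.smul_apply, smul_eq_mul]
  have h1 : σ * (a * x (Fin.last n) + b * y (Fin.last n)) =
    a * (σ * x (Fin.last n)) + b * (σ * y (Fin.last n)) := by ring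
  rw [h1]
  rcases ha.eq_or_lt with h | h
  · subst h
    have : b = 1 := by linarith
    subst this; simpa using hy
  · have := mul_pos h hx
    have := mul_nonneg hb hy.le
    linarith

lemma hbpHalf_mul {σ : ℝ} (hσ : σ * σ = 1) {x y : EuclideanSpace ℝ (Fin (n + 1))}
    (hx : 0 < σ * x (Fin.last n)) (hy : 0 < σ * y (Fin.last n)) :
    0 < x (Fin.last n) * y (Fin.last n) := by
  have := mul_pos hx hy
  have h : σ * x (Fin.last n) * (σ * y (Fin.last n)) = (σ * σ) * (x (Fin.last n) * y (Fin.last n)) := by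
    ring
  rw [h, hσ, one_mul] at this
  exact this

lemma HbpData.openZ (D : HbpData n A b c u) {m σ : ℝ} (hσ : σ * σ = 1)
    (hm : ∀ x ∈ closedBall (0 : EuclideanSpace ℝ (Fin (n + 1))) 1, m ≤ u x)
    {z : EuclideanSpace ℝ (Fin (n + 1))} (hz : z ∈ hbpHalf n σ) (huz : u z = m) :
    ∀ᶠ p in 𝓝 z, u p = m := by
  obtain ⟨ρ', hρ', hsub'⟩ := nhds_basis_closedBall.mem_iff.mp ((hbpHalf_open σ).mem_nhds hz)
  obtain ⟨ρ, hρ, hρ1, hsub⟩ : ∃ ρ > 0, ρ ≤ 1 ∧ closedBall z ρ ⊆ hbpHalf n σ :=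
    ⟨min ρ' 1, by positivity, min_le_right _ _,
      (closedBall_subset_closedBall (min_le_left _ _)).trans hsub'⟩
  filter_upwards [ball_mem_nhds z (half_pos hρ)] with p hp
  by_contra hne
  rw [mem_ball] at hp
  have hcl : IsCompact (closedBall z ρ ∩ u ⁻¹' {m}) := by
    refine (isCompact_closedBall z ρ).of_isClosed_subset ?_ inter_subset_left
    refine ContinuousOn.preimage_isClosed_of_isClosed ?_ isClosed_closedBall isClosed_singleton
    exact D.hu1.continuousOn.mono
      (hsub.trans (inter_subset_left.trans ball_subset_closedBall))
  have hzm : z ∈ closedBall z ρ ∩ u ⁻¹' {m} := ⟨mem_closedBall_self hρ.le, huz⟩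
  obtain ⟨z1, hz1, hd⟩ := hcl.exists_infDist_eq_dist ⟨z, hzm⟩ p
  have hRd : dist p z1 ≤ dist p z := by rw [← hd]; exact infDist_le_dist_of_mem hzm
  have hR : 0 < dist p z1 := by
    rw [dist_pos]; rintro rfl; exact hne hz1.2
  have hcb : closedBall p (dist p z1) ⊆ closedBall z ρ := by
    intro x hx
    rw [mem_closedBall] at *
    linarith [dist_triangle x p z]
  have hpz : p ∈ closedBall z ρ := by rw [mem_closedBall]; linarith
  have hcb' : ball p (dist p z1) ⊆ hbpHalf n σ := (ball_subset_closedBall.trans hcb).trans hsub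
  refine D.nohopf (y := p) (z := z1) hR (by linarith)
    (hcb.trans (hsub.trans (inter_subset_left.trans ball_subset_closedBall)))
    (hcb'.trans inter_subset_left) ?_ hm ?_ (dist_comm _ _) hz1.2 (hsub hz1.1).1
  · intro x hx
    exact hbpHalf_mul hσ (hsub hpz).2 (hcb' hx).2
  · intro x hx hux
    have h1 : infDist p (closedBall z ρ ∩ u ⁻¹' {m}) ≤ dist p x :=
      infDist_le_dist_of_mem ⟨hcb (ball_subset_closedBall hx), hux⟩
    rw [hd, dist_comm p x] at h1
    rw [mem_ball] at hx
    linarith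

lemma HbpData.allZ (D : HbpData n A b c u) {m σ : ℝ} (hσ : σ * σ = 1)
    (hm : ∀ x ∈ closedBall (0 : EuclideanSpace ℝ (Fin (n + 1))) 1, m ≤ u x)
    {z : EuclideanSpace ℝ (Fin (n + 1))} (hz : z ∈ hbpHalf n σ) (huz : u z = m) :
    ∀ x ∈ hbpHalf n σ, u x = m := by
  have hV : IsOpen (hbpHalf n σ ∩ u ⁻¹' {m}ᶜ) := by
    refine ContinuousOn.isOpen_inter_preimage ?_ (hbpHalf_open σ) isOpen_compl_singleton
    exact D.hu1.continuousOn.mono (inter_subset_left.trans ball_subset_closedBall)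
  have hW : IsOpen (hbpHalf n σ ∩ u ⁻¹' {m}) := by
    rw [isOpen_iff_mem_nhds]
    rintro x ⟨hx, hux⟩
    exact inter_mem ((hbpHalf_open σ).mem_nhds hx) (D.openZ hσ hm hx hux)
  have := IsPreconnected.subset_left_of_subset_union hW hV (s := hbpHalf n σ)
    (by rw [Set.disjoint_left]; rintro x ⟨_, h1⟩ ⟨_, h2⟩; exact h2 h1)
    (by
      intro x hx
      by_cases h : u x = m
      · exact Or.inl ⟨hx, h⟩
      · exact Or.inr ⟨hx, h⟩)
    ⟨z, hz, hz, huz⟩ (hbpHalf_conv σ).isPreconnected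
  exact fun x hx => (this hx).2

lemma HbpData.fromH (D : HbpData n A b c u) {m σ : ℝ} (hσ : σ * σ = 1)
    (hm : ∀ x ∈ closedBall (0 : EuclideanSpace ℝ (Fin (n + 1))) 1, m ≤ u x)
    {z : EuclideanSpace ℝ (Fin (n + 1))} (hz : z ∈ ball (0 : EuclideanSpace ℝ (Fin (n + 1))) 1)
    (hz0 : z (Fin.last n) = 0) (huz : u z = m) : ∀ x ∈ hbpHalf n σ, u x = m := by
  by_contra! hcon
  obtain ⟨x', hx', hux'⟩ := hcon
  have hno : ∀ x ∈ hbpHalf n σ, u x ≠ m := fun x hx hux => hux' (D.allZ hσ hm hx hux x' hx')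
  have hz1 : ‖z‖ < 1 := by simpa using hz
  have hσ1 : |σ| = 1 := by
    have := abs_mul_abs_self σ
    rw [hσ] at this
    nlinarith [abs_nonneg σ]
  set r := (1 - ‖z‖) / 2 with hr
  have hr0 : 0 < r := by rw [hr]; linarith
  set y := z + EuclideanSpace.single (Fin.last n) (σ * r) with hy
  have hyz : dist z y = r := by
    rw [dist_eq_norm, hy, sub_add_cancel_left, norm_neg, EuclideanSpace.norm_single, norm_mul,
      Real.norm_eq_abs, hσ1, Real.norm_of_nonneg hr0.le, one_mul]
  have hyN : y (Fin.last n) = σ * r := by simp [hy, hz0]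
  have hnx : ∀ x, ‖x‖ ≤ dist x y + r + ‖z‖ := by
    intro x
    have h1 := dist_triangle x y 0
    have h2 := dist_triangle y z 0
    rw [dist_comm y z, hyz] at h2
    simp only [dist_zero_right] at *
    linarith
  have hball : ball y r ⊆ hbpHalf n σ := by
    intro x hx
    rw [mem_ball] at hx
    refine ⟨?_, ?_⟩
    · rw [mem_ball_zero_iff]
      have := hnx x
      linarith
    · have h3 : |(x - y) (Fin.last n)| < r :=
        lt_of_le_of_lt (PiLp.norm_apply_le (x - y) (Fin.last n)) (by rwa [← dist_eq_norm])
      have h4 : |σ * (x - y) (Fin.last n)| < r := by rw [abs_mul, hσ1, one_mul]; exact h3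
      have h5 := (abs_lt.mp h4).1
      have h6 : σ * (x - y) (Fin.last n) = σ * x (Fin.last n) - r := by
        rw [PiLp.sub_apply, hyN, mul_sub, ← mul_assoc, hσ, one_mul]
      show 0 < σ * x (Fin.last n)
      linarith
  refine D.nohopf (y := y) (z := z) hr0 (by linarith [norm_nonneg z]) ?_
    (hball.trans inter_subset_left) ?_ hm (fun x hx => hno x (hball hx)) hyz huz hz
  · intro x hx
    rw [mem_closedBall] at hx
    rw [mem_closedBall_zero_iff]
    have := hnx x
    linarith
  · intro x hx
    exact hbpHalf_mul hσ (hball (mem_ball_self hr0)).2 (hball hx).2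

lemma HbpData.toH (D : HbpData n A b c u) {m σ : ℝ} (hσ : σ * σ = 1)
    (hall : ∀ x ∈ hbpHalf n σ, u x = m)
    {z : EuclideanSpace ℝ (Fin (n + 1))} (hz : z ∈ ball (0 : EuclideanSpace ℝ (Fin (n + 1))) 1)
    (hz0 : z (Fin.last n) = 0) : u z = m := by
  have hl : Tendsto (fun t : ℝ => z + t • EuclideanSpace.single (Fin.last n) σ) (𝓝[>] 0) (𝓝 z) :=
    (hbp_line_tendsto z _).mono_left nhdsWithin_le_nhds
  have h1 := (D.cda hz).continuousAt.tendsto.comp hl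
  refine tendsto_nhds_unique h1 (tendsto_const_nhds.congr' ?_)
  filter_upwards [hl.eventually (isOpen_ball.mem_nhds hz), self_mem_nhdsWithin] with t ht ht0
  refine (hall _ ⟨ht, ?_⟩).symm
  have : (z + t • EuclideanSpace.single (Fin.last n) σ) (Fin.last n) = t * σ := by simp [hz0]
  show 0 < σ * (z + t • EuclideanSpace.single (Fin.last n) σ) (Fin.last n)
  rw [this, mul_left_comm, hσ, mul_one]
  exact ht0

lemma HbpData.strong (D : HbpData n A b c u) {m : ℝ}
    (hm : ∀ x ∈ closedBall (0 : EuclideanSpace ℝ (Fin (n + 1))) 1, m ≤ u x)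
    {z : EuclideanSpace ℝ (Fin (n + 1))} (hz : z ∈ ball (0 : EuclideanSpace ℝ (Fin (n + 1))) 1)
    (huz : u z = m) : ∀ x ∈ ball (0 : EuclideanSpace ℝ (Fin (n + 1))) 1, u x = m := by
  have s1 : (1:ℝ) * 1 = 1 := by norm_num
  have s2 : (-1:ℝ) * -1 = 1 := by norm_num
  have h0 : u 0 = m := by
    rcases lt_trichotomy (z (Fin.last n)) 0 with h | h | h
    · exact D.toH s2 (D.allZ s2 hm (z := z) ⟨hz, by simpa using h⟩ huz) (by simp) (by simp)
    · exact D.toH s1 (D.fromH s1 hm hz h huz) (by simp) (by simp)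
    · exact D.toH s1 (D.allZ s1 hm (z := z) ⟨hz, by simpa using h⟩ huz) (by simp) (by simp)
  intro x hx
  have hp := D.fromH s1 hm (z := 0) (by simp) (by simp) h0
  have hn := D.fromH s2 hm (z := 0) (by simp) (by simp) h0
  rcases lt_trichotomy (x (Fin.last n)) 0 with h | h | h
  · exact hn x ⟨hx, by simpa using h⟩
  · exact D.toH s1 hp hx h
  · exact hp x ⟨hx, by simpa using h⟩

end

/-- Lemma 2.2: Hopf boundary-point lemma for the singular/degenerate operator
`L u = Σ a_{ij} ∂_{ij} u + Σ b_i ∂_i u + (a(x)/x_{n+1}) ∂_{n+1} u` in the unit ball.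
The outward normal derivative at `x⁰ ∈ ∂B₁` is `fderivWithin ℝ u (closedBall 0 1) x⁰ x⁰`,
since the outward unit normal at `x⁰` is `x⁰` itself. -/
theorem hopf_boundary_point (n : ℕ)
    (A : Fin (n + 1) → Fin (n + 1) → EuclideanSpace ℝ (Fin (n + 1)) → ℝ)
    (b : Fin n → EuclideanSpace ℝ (Fin (n + 1)) → ℝ)
    (c : EuclideanSpace ℝ (Fin (n + 1)) → ℝ)
    (hA : ∀ i j, Continuous (A i j)) (hb : ∀ i, Continuous (b i)) (hc : Continuous c)
    (hc0 : ∀ x, 0 ≤ c x)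
    (hell : ∀ (x : EuclideanSpace ℝ (Fin (n + 1))) (v : Fin (n + 1) → ℝ), v ≠ 0 →
      0 < ∑ i, ∑ j, A i j x * v i * v j)
    (u : EuclideanSpace ℝ (Fin (n + 1)) → ℝ)
    (hu2 : ContDiffOn ℝ 2 u (Metric.ball (0 : EuclideanSpace ℝ (Fin (n + 1))) 1))
    (hu1 : ContDiffOn ℝ 1 u (Metric.closedBall (0 : EuclideanSpace ℝ (Fin (n + 1))) 1))
    (hbdry : ∀ x ∈ Metric.ball (0 : EuclideanSpace ℝ (Fin (n + 1))) 1,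
      x (Fin.last n) = 0 → pd u (Fin.last n) x = 0)
    (hsuper : ∀ x ∈ Metric.ball (0 : EuclideanSpace ℝ (Fin (n + 1))) 1,
      x (Fin.last n) ≠ 0 →
      (∑ i, ∑ j, A i j x * pd2 u i j x) + (∑ i : Fin n, b i x * pd u i.castSucc x) +
        (c x / x (Fin.last n)) * pd u (Fin.last n) x ≤ 0)
    (x₀ : EuclideanSpace ℝ (Fin (n + 1)))
    (hx₀ : x₀ ∈ Metric.sphere (0 : EuclideanSpace ℝ (Fin (n + 1))) 1)
    (hmin : ∀ x ∈ Metric.closedBall (0 : EuclideanSpace ℝ (Fin (n + 1))) 1, u x₀ ≤ u x) :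
    (∀ x ∈ Metric.closedBall (0 : EuclideanSpace ℝ (Fin (n + 1))) 1,
        ∀ y ∈ Metric.closedBall (0 : EuclideanSpace ℝ (Fin (n + 1))) 1, u x = u y) ∨
    fderivWithin ℝ u (Metric.closedBall (0 : EuclideanSpace ℝ (Fin (n + 1))) 1) x₀ x₀ < 0 := by
  have D : HbpData n A b c u := ⟨hA, hb, hc, hc0, hell, hu2, hu1, hbdry, hsuper⟩
  by_cases h : ∃ z ∈ Metric.ball (0 : EuclideanSpace ℝ (Fin (n + 1))) 1, u z = u x₀
  · left
    obtain ⟨z, hz, huz⟩ := h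
    have hall := D.strong hmin hz huz
    have hcl : ∀ x ∈ Metric.closedBall (0 : EuclideanSpace ℝ (Fin (n + 1))) 1, u x = u x₀ := by
      have hE : Set.EqOn u (fun _ => u x₀) (Metric.ball (0 : EuclideanSpace ℝ (Fin (n + 1))) 1) :=
        hall
      exact hE.of_subset_closure hu1.continuousOn continuousOn_const
        Metric.ball_subset_closedBall (closure_ball _ one_ne_zero).symm.subset
    intro x hx y hy
    rw [hcl x hx, hcl y hy]
  · right
    push Not at h
    have := D.hopf (y := 0) (z := x₀) (R := 1) (m := u x₀) one_pos le_rfl subset_rfl subset_rfl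
      (fun _ _ => Or.inl (by simp)) hmin
      (fun x hx => lt_of_le_of_ne (hmin x (Metric.ball_subset_closedBall hx)) (h x hx).symm)
      (by simpa using hx₀) rfl
    simpa using this
end

section
/- Let n ≥ 1 and a be constants with n + 2a > 2, and let v be a real-valued C¹ function defined on {x ∈ ℝ^{n+1} : |x| > R₀} for some R₀ > 0, satisfying the asymptotic expansion: there exist constants a₀ > 0, a₁, …, a_{n+1} ∈ ℝ and C > 0 such that for all |x| ≥ R₀, |v(x) − a₀/|x|^{n+2a−2} − Σ_{i=1}^{n+1} aᵢxᵢ/|x|^{n+2a}| ≤ C/|x|^{n+2a} and |∂ᵢv(x) + (n+2a−2)a₀xᵢ/|x|^{n+2a}| ≤ C/|x|^{n+2a} for each i. Then there exist positive constants R and λ₁ such that for every λ ≥ λ₁ and every x with x₁ < λ and |x| > R, one has v(x) > v(x^λ), where x^λ = (2λ−x₁, x₂, …, x_{n+1}). -/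
/-- The reflection `x^λ = (2λ - x₁, x₂, …, x_{n+1})` across the hyperplane `{x₁ = λ}`. -/
noncomputable def reflPt (n : ℕ) (lam : ℝ) (x : EuclideanSpace ℝ (Fin (n + 1))) :
    EuclideanSpace ℝ (Fin (n + 1)) :=
  WithLp.toLp 2 (Function.update x 0 (2 * lam - x 0))

theorem mp_key (p r s : ℝ) (hp : 0 < p) (hr : 0 < r) (hs : 0 < s) :
    p / 2 * (s ^ p)⁻¹ * (s ^ 2 - r ^ 2) ≤ ((r ^ p)⁻¹ - (s ^ p)⁻¹) * s ^ 2 := by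
  have h1 : Real.log ((r / s) ^ 2) ≤ (r / s) ^ 2 - 1 := Real.log_le_sub_one_of_pos (by positivity)
  have h2 : s ^ p / r ^ p = Real.exp (-(p / 2) * Real.log ((r / s) ^ 2)) := by
    rw [Real.log_pow, Real.log_div hr.ne' hs.ne', Real.rpow_def_of_pos hr, Real.rpow_def_of_pos hs,
      ← Real.exp_sub]
    congr 1
    push_cast
    ring
  have h3 := Real.add_one_le_exp (-(p / 2) * Real.log ((r / s) ^ 2))
  rw [← h2] at h3
  have h4 : p / 2 * (1 - (r / s) ^ 2) ≤ s ^ p / r ^ p - 1 := by nlinarith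
  have hsp : 0 < s ^ p := Real.rpow_pos_of_pos hs p
  have hrp : 0 < r ^ p := Real.rpow_pos_of_pos hr p
  have h5 := mul_le_mul_of_nonneg_right h4 (by positivity : 0 ≤ (s ^ p)⁻¹ * s ^ 2)
  calc _ = p / 2 * (1 - (r / s) ^ 2) * ((s ^ p)⁻¹ * s ^ 2) := by field_simp
    _ ≤ _ := h5
    _ = _ := by field_simp

set_option maxHeartbeats 1000000 in
theorem mp_scalar (p r s U W l d a₀ C N A Sx : ℝ) (hp : 0 < p) (hr : 0 < r) (hs : 0 < s)
    (hU : 0 < U) (hW : 0 < W) (hl : 0 < l) (hd : 1 ≤ d) (ha : 0 < a₀) (hC : 0 < C)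
    (hsr : s ^ 2 = r ^ 2 + 4 * l * d)
    (key : p / 2 * W * (s ^ 2 - r ^ 2) ≤ (U - W) * s ^ 2)
    (hSx : |Sx| ≤ N * r)
    (h1 : N * (1 + 2 / p) ≤ a₀ / 4 * r)
    (h2 : |A| ≤ a₀ / 4 * (p * l))
    (h3 : 8 * C / a₀ < r ^ 2) (h4 : 32 * C / (a₀ * p) < r ^ 2)
    (h5 : 8 * C / (a₀ * p) < l) :
    a₀ * W + (Sx + 2 * d * A) * (W / s ^ 2) + C * (W / s ^ 2)
      < a₀ * U + Sx * (U / r ^ 2) - C * (U / r ^ 2) := by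
  have hld : l ≤ l * d := by nlinarith
  have hr2 : 0 < r ^ 2 := by positivity
  have hs2 : 0 < s ^ 2 := by positivity
  have hlt : r ^ 2 < s ^ 2 := by nlinarith
  have hWU : W < U := by
    have : 0 < p / 2 * W * (s ^ 2 - r ^ 2) := by
      have : 0 < s ^ 2 - r ^ 2 := by linarith
      positivity
    have := pos_of_mul_pos_left (lt_of_lt_of_le this key) hs2.le
    linarith
  obtain ⟨P, hP⟩ : ∃ P, P = U / r ^ 2 := ⟨_, rfl⟩
  obtain ⟨Q, hQ⟩ : ∃ Q, Q = W / s ^ 2 := ⟨_, rfl⟩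
  rw [← hP, ← hQ]
  have hPp : 0 < P := by rw [hP]; positivity
  have hQp : 0 < Q := by rw [hQ]; positivity
  have hUP : U = P * r ^ 2 := by rw [hP]; field_simp
  have hWQ : W = Q * s ^ 2 := by rw [hQ]; field_simp
  have hkey2 : p / 2 * Q * (s ^ 2 - r ^ 2) ≤ U - W := by
    have : p / 2 * Q * (s ^ 2 - r ^ 2) = (p / 2 * W * (s ^ 2 - r ^ 2)) / s ^ 2 := by
      rw [hQ]; field_simp
    rw [this, div_le_iff₀ hs2]; exact key
  have hQP : Q ≤ P := by
    rw [hQ, hP]; gcongr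
  -- term 1
  have t1 : |Sx| * (P - Q) ≤ a₀ / 4 * (U - W) := by
    have e1 : (P - Q) * r ^ 2 ≤ (1 + 2 / p) * (U - W) := by
      have : Q * (s ^ 2 - r ^ 2) ≤ 2 / p * (U - W) := by
        rw [div_mul_eq_mul_div, le_div_iff₀ hp]; nlinarith
      nlinarith
    have e2 : |Sx| * (P - Q) ≤ N * r * (P - Q) :=
      mul_le_mul_of_nonneg_right hSx (by linarith)
    have hN : 0 ≤ N := by
      by_contra h
      have := abs_nonneg Sx
      nlinarith
    have e3 : (N * r * (P - Q)) * r ≤ (a₀ / 4 * (U - W)) * r := by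
      calc (N * r * (P - Q)) * r = N * ((P - Q) * r ^ 2) := by ring
        _ ≤ N * ((1 + 2 / p) * (U - W)) := by gcongr
        _ = (N * (1 + 2 / p)) * (U - W) := by ring
        _ ≤ (a₀ / 4 * r) * (U - W) := mul_le_mul_of_nonneg_right h1 (by linarith)
        _ = _ := by ring
    exact e2.trans (le_of_mul_le_mul_right e3 hr)
  have t2 : 2 * d * |A| * Q ≤ a₀ / 4 * (U - W) := by
    calc 2 * d * |A| * Q ≤ 2 * d * (a₀ / 4 * (p * l)) * Q := by gcongr
      _ = a₀ / 4 * (p / 2 * Q * (4 * l * d)) := by ring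
      _ ≤ _ := by
        gcongr
        rw [hsr] at hkey2
        linarith
  have t3 : 4 * C * P < a₀ * (U - W) := by
    rw [div_lt_iff₀ (by positivity)] at h3 h4 h5
    have m3 := mul_lt_mul_of_pos_right h3 hPp
    have m4 := mul_lt_mul_of_pos_right h4 hPp
    have m5 := mul_lt_mul_of_pos_right h5 hPp
    by_cases c1 : W ≤ U / 2
    · have : a₀ * (U / 2) ≤ a₀ * (U - W) := by gcongr; linarith
      rw [hUP] at this ⊢
      nlinarith
    · push Not at c1
      by_cases c2 : s ^ 2 ≤ 2 * r ^ 2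
      · have q1 : P / 4 ≤ Q := by
          rw [hP, hQ, div_div, div_le_div_iff₀ (by positivity) hs2]
          calc U * s ^ 2 ≤ (2 * W) * (2 * r ^ 2) := by gcongr; linarith
            _ = _ := by ring
        have q2 : p / 2 * (P / 4) * (4 * (l)) ≤ U - W := by
          refine le_trans ?_ hkey2
          rw [hsr]
          gcongr
          linarith
        have q3 := mul_le_mul_of_nonneg_left q2 ha.le
        linarith
      · push Not at c2
        have q2 : p / 2 * (W / 2) ≤ U - W := by
          refine le_trans ?_ hkey2
          rw [hWQ]
          have : 0 < p / 2 * Q := by positivity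
          nlinarith
        have q3 : p / 8 * U ≤ U - W := by
          have := mul_le_mul_of_nonneg_left c1.le (by positivity : 0 ≤ p / 4)
          linarith
        have q4 := mul_le_mul_of_nonneg_left q3 ha.le
        have : a₀ * (p / 8 * U) = a₀ * (p / 8) * (P * r ^ 2) := by rw [hUP]; ring
        linarith
  have u1 : -(|Sx| * (P - Q)) ≤ Sx * (P - Q) := by
    have := mul_le_mul_of_nonneg_right (neg_abs_le Sx) (by linarith : 0 ≤ P - Q)
    linarith
  have u2 : 2 * d * A * Q ≤ 2 * d * |A| * Q := by
    gcongr; exact le_abs_self A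
  have u3 : C * Q ≤ C * P := by gcongr
  nlinarith

theorem mp_refl (n : ℕ) (lam : ℝ) (x : EuclideanSpace ℝ (Fin (n + 1))) :
    reflPt n lam x = x + (2 * (lam - x 0)) • EuclideanSpace.single 0 1 := by
  ext i
  by_cases h : i = 0
  · subst h; simp [reflPt]; ring
  · simp [reflPt, h]

/-- Lemma 2.3: the asymptotic expansion at infinity forces the plane-reflection
inequality `v(x) > v(x^λ)` for all sufficiently far planes. -/
theorem moving_plane_start (n : ℕ) (hn : 1 ≤ n) (a : ℝ) (hna : 2 < n + 2 * a)
    (R₀ : ℝ) (hR₀ : 0 < R₀)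
    (v : EuclideanSpace ℝ (Fin (n + 1)) → ℝ)
    (hv : ContDiffOn ℝ 1 v {x : EuclideanSpace ℝ (Fin (n + 1)) | R₀ < ‖x‖})
    (a₀ : ℝ) (ha₀ : 0 < a₀) (aa : Fin (n + 1) → ℝ) (C : ℝ) (hC : 0 < C)
    (hasym : ∀ x : EuclideanSpace ℝ (Fin (n + 1)), R₀ ≤ ‖x‖ →
      |v x - a₀ / ‖x‖ ^ ((n : ℝ) + 2 * a - 2) - ∑ i, aa i * x i / ‖x‖ ^ ((n : ℝ) + 2 * a)|
        ≤ C / ‖x‖ ^ ((n : ℝ) + 2 * a))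
    (hasym' : ∀ x : EuclideanSpace ℝ (Fin (n + 1)), R₀ ≤ ‖x‖ → ∀ i,
      |pd v i x + ((n : ℝ) + 2 * a - 2) * a₀ * x i / ‖x‖ ^ ((n : ℝ) + 2 * a)|
        ≤ C / ‖x‖ ^ ((n : ℝ) + 2 * a)) :
    ∃ R > 0, ∃ lam₁ > 0, ∀ lam ≥ lam₁, ∀ x : EuclideanSpace ℝ (Fin (n + 1)),
      x 0 < lam → R < ‖x‖ → v (reflPt n lam x) < v x := by
  obtain ⟨p, hpdef⟩ : ∃ p : ℝ, p = (n : ℝ) + 2 * a - 2 := ⟨_, rfl⟩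
  have hp : 0 < p := by linarith
  have hp2 : (n : ℝ) + 2 * a = p + 2 := by linarith
  rw [← hpdef] at hasym hasym'
  rw [hp2] at hasym hasym'
  obtain ⟨N, hN⟩ : ∃ N : ℝ, N = ∑ i, |aa i| := ⟨_, rfl⟩
  have hN0 : 0 ≤ N := by rw [hN]; positivity
  obtain ⟨K, hK⟩ : ∃ K : ℝ, K = R₀ + 1 + C / (p * a₀) := ⟨_, rfl⟩
  have hCp : 0 < C / (p * a₀) := by positivity
  have b1 : 0 ≤ 4 * (N * (1 + 2 / p)) / a₀ := by positivity
  have b2 : 0 < 8 * C / a₀ := by positivity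
  have b3 : 0 < 32 * C / (a₀ * p) := by positivity
  have b4 : 0 ≤ 4 * |aa 0| / (a₀ * p) := by positivity
  have b5 : 0 < 8 * C / (a₀ * p) := by positivity
  refine ⟨R₀ + 1 + 4 * (N * (1 + 2 / p)) / a₀ + 8 * C / a₀ + 32 * C / (a₀ * p), by positivity,
    K + 1 + 4 * |aa 0| / (a₀ * p) + 8 * C / (a₀ * p), by linarith, ?_⟩
  intro lam hlam x hx hxR
  have hd : 0 < lam - x 0 := by linarith
  by_cases hxK : K ≤ x 0
  · -- monotone region
    rw [mp_refl]
    have hcoord : ∀ t : ℝ, (x + t • (EuclideanSpace.single 0 1 :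
        EuclideanSpace ℝ (Fin (n + 1)))) 0 = x 0 + t := by
      intro t; simp
    have hnorm : ∀ t : ℝ, 0 ≤ t → R₀ < ‖x + t • (EuclideanSpace.single 0 1 :
        EuclideanSpace ℝ (Fin (n + 1)))‖ := by
      intro t ht
      have h1 := PiLp.norm_apply_le (x + t • (EuclideanSpace.single 0 1 :
        EuclideanSpace ℝ (Fin (n + 1)))) 0
      rw [hcoord, Real.norm_eq_abs] at h1
      have h2 := le_abs_self (x 0 + t)
      linarith
    have hder : ∀ t : ℝ, 0 ≤ t → HasDerivAt (fun t : ℝ => v (x + t •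
        (EuclideanSpace.single 0 1 : EuclideanSpace ℝ (Fin (n + 1)))))
        (pd v 0 (x + t • (EuclideanSpace.single 0 1))) t := by
      intro t ht
      have hopen : IsOpen {x : EuclideanSpace ℝ (Fin (n + 1)) | R₀ < ‖x‖} :=
        isOpen_lt continuous_const continuous_norm
      have hdv := ((hv.differentiableOn (by norm_num)).differentiableAt
        (hopen.mem_nhds (hnorm t ht))).hasFDerivAt
      have hl : HasDerivAt (fun t : ℝ => x + t •
        (EuclideanSpace.single 0 1 : EuclideanSpace ℝ (Fin (n + 1))))
        (EuclideanSpace.single 0 1) t := by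
        simpa using ((hasDerivAt_id t).smul_const
          (EuclideanSpace.single 0 1 : EuclideanSpace ℝ (Fin (n + 1)))).const_add x
      exact hdv.comp_hasDerivAt t hl
    have hneg : ∀ t : ℝ, 0 ≤ t → pd v 0 (x + t • (EuclideanSpace.single 0 1)) < 0 := by
      intro t ht
      have h1 := (abs_le.1 (hasym' _ (hnorm t ht).le 0)).2
      rw [hcoord] at h1
      have hpos : 0 < ‖x + t • (EuclideanSpace.single 0 1 :
        EuclideanSpace ℝ (Fin (n + 1)))‖ ^ (p + 2) :=
        Real.rpow_pos_of_pos (hR₀.trans (hnorm t ht)) _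
      have h2 : C < p * a₀ * (x 0 + t) := by
        have : C / (p * a₀) < x 0 + t := by linarith
        rw [div_lt_iff₀ (by positivity)] at this
        linarith
      have h3 := div_lt_div_of_pos_right h2 hpos
      linarith
    have hanti := strictAntiOn_of_deriv_neg (convex_Ici (0:ℝ))
      (f := fun t : ℝ => v (x + t •
        (EuclideanSpace.single 0 1 : EuclideanSpace ℝ (Fin (n + 1)))))
      (fun t ht => (hder t ht).continuousAt.continuousWithinAt)
      (fun t ht => by
        have ht' : 0 ≤ t := interior_subset ht
        rw [(hder t ht').deriv]; exact hneg t ht')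
    have := hanti (a := 0) (b := 2 * (lam - x 0)) (by simp) (by simp; linarith) (by linarith)
    simpa using this
  · push Not at hxK
    obtain ⟨y, hy⟩ : ∃ y, y = reflPt n lam x := ⟨_, rfl⟩
    rw [← hy]
    have hyi : ∀ i, y i = x i + 2 * (lam - x 0) * (if i = 0 then 1 else 0) := by
      intro i; rw [hy, mp_refl]; simp
    have hnr : 0 < ‖x‖ := by linarith
    have hsr : ‖y‖ ^ 2 = ‖x‖ ^ 2 + 4 * lam * (lam - x 0) := by
      rw [EuclideanSpace.real_norm_sq_eq, EuclideanSpace.real_norm_sq_eq, Fin.sum_univ_succ,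
        Fin.sum_univ_succ]
      simp [hyi]
      ring
    have hlam0 : 0 < lam := by linarith
    have hxy : ‖x‖ < ‖y‖ := by
      refine lt_of_pow_lt_pow_left₀ 2 (norm_nonneg _) ?_
      have : 0 < lam * (lam - x 0) := by positivity
      rw [hsr]; linarith
    have hns : 0 < ‖y‖ := by linarith
    have hSy : ∑ i, aa i * y i = ∑ i, aa i * x i + 2 * (lam - x 0) * aa 0 := by
      rw [Fin.sum_univ_succ, Fin.sum_univ_succ]
      simp [hyi]
      ring
    have hSx : |∑ i, aa i * x i| ≤ N * ‖x‖ := by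
      rw [hN, Finset.sum_mul]
      refine (Finset.abs_sum_le_sum_abs _ _).trans (Finset.sum_le_sum fun i _ => ?_)
      rw [abs_mul]
      gcongr
      exact PiLp.norm_apply_le x i
    have hxa := (abs_le.1 (hasym x (by linarith))).1
    have hya := (abs_le.1 (hasym y (by linarith))).2
    rw [← Finset.sum_div] at hxa hya
    rw [hSy] at hya
    have hrp : 0 < ‖x‖ ^ p := Real.rpow_pos_of_pos hnr p
    have hsp : 0 < ‖y‖ ^ p := Real.rpow_pos_of_pos hns p
    have hR1 : ‖x‖ ≤ ‖x‖ ^ 2 := by nlinarith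
    have ex : ∀ (c z : ℝ), c / (z ^ p * z ^ 2) = c * ((z ^ p)⁻¹ / z ^ 2) := by
      intro c z
      rw [div_eq_mul_inv, mul_inv, div_eq_mul_inv]
    rw [Real.rpow_add hnr, Real.rpow_two, ex, ex, div_eq_mul_inv a₀] at hxa
    rw [Real.rpow_add hns, Real.rpow_two, ex, ex, div_eq_mul_inv a₀] at hya
    have main := mp_scalar p ‖x‖ ‖y‖ (‖x‖ ^ p)⁻¹ (‖y‖ ^ p)⁻¹ lam (lam - x 0) a₀ C N (aa 0)
      (∑ i, aa i * x i) hp hnr hns (by positivity) (by positivity) hlam0 (by linarith) ha₀ hC hsr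
      (mp_key p _ _ hp hnr hns) hSx
      (by
        have : 4 * (N * (1 + 2 / p)) / a₀ ≤ ‖x‖ := by linarith
        rw [div_le_iff₀ ha₀] at this
        linarith)
      (by
        have : 4 * |aa 0| / (a₀ * p) ≤ lam := by linarith
        rw [div_le_iff₀ (by positivity)] at this
        linarith)
      (by linarith) (by linarith) (by linarith)
    linarith
end

section
/- Let n ≥ 1, let a be a constant with n + 2a > 2, let t > 0 and x₀ ∈ ℝⁿ, and set α = (n+2a+2)/(n+2a−2). Then the function u(x,y) = ( t·√((n+2a)(n+2a−2)) / (t² + 4y + |x−x₀|²) )^{(n+2a−2)/2} is positive, smooth on ℝⁿ × [0,∞), and satisfies y·∂²u/∂y² + a·∂u/∂y + Δₓu + u^α = 0 at every point of ℝⁿ × (0,∞). -/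
/-- Second partial derivative in the `i`-th `x`-variable. -/
noncomputable def pdxx (n : ℕ) (u : (Fin n → ℝ) × ℝ → ℝ) (i : Fin n)
    (x : Fin n → ℝ) (y : ℝ) : ℝ :=
  deriv (fun t => deriv (fun s => u (Function.update x i s, y)) t) (x i)

/-- First partial derivative in the `y`-variable. -/
noncomputable def pdy (n : ℕ) (u : (Fin n → ℝ) × ℝ → ℝ) (x : Fin n → ℝ) (y : ℝ) : ℝ :=
  deriv (fun t => u (x, t)) y

/-- Second partial derivative in the `y`-variable. -/
noncomputable def pdyy (n : ℕ) (u : (Fin n → ℝ) × ℝ → ℝ) (x : Fin n → ℝ) (y : ℝ) : ℝ :=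
  deriv (fun t => deriv (fun s => u (x, s)) t) y

theorem aux_d1 (C m B b c e s : ℝ) (hC : 0 < C) (hq : 0 < B + b * s + c * (s - e) ^ 2) :
    HasDerivAt (fun s => (C / (B + b * s + c * (s - e) ^ 2)) ^ m)
      (-m * ((b + 2 * c * (s - e)) / (B + b * s + c * (s - e) ^ 2)) *
        (C / (B + b * s + c * (s - e) ^ 2)) ^ m) s := by
  have h1 : HasDerivAt (fun s : ℝ => B + b * s + c * (s - e) ^ 2) (b + 2 * c * (s - e)) s := by
    have := (((hasDerivAt_id s).const_mul b).const_add B).add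
      ((((hasDerivAt_id s).sub_const e).pow 2).const_mul c)
    refine HasDerivAt.congr_deriv (f := fun s : ℝ => B + b * s + c * (s - e) ^ 2) this ?_
    simp
    ring
  have hpos : 0 < C / (B + b * s + c * (s - e) ^ 2) := by positivity
  have h2 := ((hasDerivAt_const s C).div h1 hq.ne').rpow_const (p := m) (Or.inl hpos.ne')
  refine HasDerivAt.congr_deriv h2 ?_
  change (0 * (B + b * s + c * (s - e) ^ 2) - C * (b + 2 * c * (s - e))) /
    (B + b * s + c * (s - e) ^ 2) ^ 2 * m * (C / (B + b * s + c * (s - e) ^ 2)) ^ (m - 1) = _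
  rw [Real.rpow_sub_one hpos.ne']
  field_simp
  ring

theorem aux_d2 (C m B b c e s : ℝ) (hC : 0 < C) (hq : 0 < B + b * s + c * (s - e) ^ 2) :
    deriv (fun r => deriv (fun s => (C / (B + b * s + c * (s - e) ^ 2)) ^ m) r) s =
      (m * (m + 1) * (b + 2 * c * (s - e)) ^ 2 - 2 * m * c * (B + b * s + c * (s - e) ^ 2)) /
        (B + b * s + c * (s - e) ^ 2) ^ 2 * (C / (B + b * s + c * (s - e) ^ 2)) ^ m := by
  have hc : Continuous (fun s : ℝ => B + b * s + c * (s - e) ^ 2) := by fun_prop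
  have hev : ∀ᶠ r in nhds s, 0 < B + b * r + c * (r - e) ^ 2 :=
    hc.continuousAt.eventually (lt_mem_nhds hq)
  have heq : (fun r => deriv (fun s => (C / (B + b * s + c * (s - e) ^ 2)) ^ m) r) =ᶠ[nhds s]
      fun r => (-m * ((b + 2 * c * (r - e)) / (B + b * r + c * (r - e) ^ 2)) *
        (C / (B + b * r + c * (r - e) ^ 2)) ^ m) := by
    filter_upwards [hev] with r hr
    exact (aux_d1 C m B b c e r hC hr).deriv
  rw [heq.deriv_eq]
  have h1 : HasDerivAt (fun s : ℝ => B + b * s + c * (s - e) ^ 2) (b + 2 * c * (s - e)) s := by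
    have := (((hasDerivAt_id s).const_mul b).const_add B).add
      ((((hasDerivAt_id s).sub_const e).pow 2).const_mul c)
    refine HasDerivAt.congr_deriv (f := fun s : ℝ => B + b * s + c * (s - e) ^ 2) this ?_
    simp
    ring
  have h3 : HasDerivAt (fun s : ℝ => b + 2 * c * (s - e)) (2 * c) s := by
    simpa using (((hasDerivAt_id s).sub_const e).const_mul (2 * c)).const_add b
  have h4 := ((h3.div h1 hq.ne').const_mul (-m)).mul (aux_d1 C m B b c e s hC hq)
  have h5 := h4.deriv
  refine Eq.trans h5 ?_
  change (-m * ((2 * c * (B + b * s + c * (s - e) ^ 2) - (b + 2 * c * (s - e)) * (b + 2 * c * (s - e))) / (B + b * s + c * (s - e) ^ 2) ^ 2)) * (C / (B + b * s + c * (s - e) ^ 2)) ^ m + (-m * ((b + 2 * c * (s - e)) / (B + b * s + c * (s - e) ^ 2))) * _ = _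
  field_simp
  ring

/-- The explicit two-parameter family of Theorem 1.1(2) solves the critical
degenerate equation `y u_yy + a u_y + Δₓ u + u^α = 0`. -/
theorem explicit_family_solves (n : ℕ) (hn : 1 ≤ n) (a : ℝ) (hna : 2 < n + 2 * a)
    (t : ℝ) (ht : 0 < t) (x₀ : Fin n → ℝ) (α : ℝ)
    (hα : α = (n + 2 * a + 2) / (n + 2 * a - 2))
    (u : (Fin n → ℝ) × ℝ → ℝ)
    (hu : u = fun p => (t * Real.sqrt ((n + 2 * a) * (n + 2 * a - 2)) /
      (t ^ 2 + 4 * p.2 + ∑ i, (p.1 i - x₀ i) ^ 2)) ^ ((n + 2 * a - 2) / 2)) :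
    (∀ (x : Fin n → ℝ) (y : ℝ), 0 ≤ y → 0 < u (x, y)) ∧
    ContDiffOn ℝ (⊤ : ℕ∞) u {p : (Fin n → ℝ) × ℝ | 0 ≤ p.2} ∧
    (∀ (x : Fin n → ℝ) (y : ℝ), 0 < y →
      y * pdyy n u x y + a * pdy n u x y + (∑ i, pdxx n u i x y) + u (x, y) ^ α = 0) := by
  have hm : (0 : ℝ) < n + 2 * a - 2 := by linarith
  have hk : (0 : ℝ) < n + 2 * a := by linarith
  obtain ⟨C, hCdef⟩ : ∃ C, C = t * Real.sqrt ((n + 2 * a) * (n + 2 * a - 2)) := ⟨_, rfl⟩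
  have hC : 0 < C := by rw [hCdef]; positivity
  have hC2 : C ^ 2 = t ^ 2 * ((n + 2 * a) * (n + 2 * a - 2)) := by
    rw [hCdef, mul_pow, Real.sq_sqrt (by positivity)]
  rw [← hCdef] at hu
  obtain ⟨m, hmdef⟩ : ∃ m : ℝ, m = (n + 2 * a - 2) / 2 := ⟨_, rfl⟩
  rw [← hmdef] at hu
  have hD : ∀ (x : Fin n → ℝ) (y : ℝ), 0 ≤ y → 0 < t ^ 2 + 4 * y + ∑ i, (x i - x₀ i) ^ 2 := by
    intro x y hy
    have : 0 ≤ ∑ i, (x i - x₀ i) ^ 2 := Finset.sum_nonneg fun i _ => sq_nonneg _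
    positivity
  refine ⟨?_, ?_, ?_⟩
  · intro x y hy
    have := hD x y hy
    rw [hu]
    exact Real.rpow_pos_of_pos (div_pos hC this) _
  · rw [hu]
    intro p hp
    have h := hD p.1 p.2 hp
    apply ContDiffAt.contDiffWithinAt
    apply ContDiffAt.rpow_const_of_ne
    · apply ContDiffAt.div
      · fun_prop
      · fun_prop
      · exact h.ne'
    · exact (div_pos hC h).ne'
  · intro x y hy
    have h := hD x y hy.le
    obtain ⟨R, hR⟩ : ∃ R, R = ∑ i, (x i - x₀ i) ^ 2 := ⟨_, rfl⟩
    rw [← hR] at h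
    obtain ⟨D, hDdef⟩ : ∃ D, D = t ^ 2 + 4 * y + R := ⟨_, rfl⟩
    rw [← hDdef] at h
    have hfun : (fun s => u (x, s)) =
        fun s => (C / ((t ^ 2 + R) + 4 * s + 0 * (s - 0) ^ 2)) ^ m := by
      funext s
      simp only [hu, ← hR]
      congr 2
      ring
    have hq : (t ^ 2 + R) + 4 * y + 0 * (y - 0) ^ 2 = D := by rw [hDdef]; ring
    have e1 : pdy n u x y = -m * (4 / D) * (C / D) ^ m := by
      unfold pdy
      rw [hfun, (aux_d1 C m _ _ _ _ y hC (by rw [hq]; exact h)).deriv, hq]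
      ring
    have e2 : pdyy n u x y = (m * (m + 1) * 16) / D ^ 2 * (C / D) ^ m := by
      unfold pdyy
      rw [hfun, aux_d2 C m _ _ _ _ y hC (by rw [hq]; exact h), hq]
      ring
    have e3 : ∀ i, pdxx n u i x y = (m * (m + 1) * 4 * (x i - x₀ i) ^ 2 - 2 * m * D) / D ^ 2
        * (C / D) ^ m := by
      intro i
      have hfun : (fun s => u (Function.update x i s, y)) =
          fun s => (C / ((D - (x i - x₀ i) ^ 2) + 0 * s + 1 * (s - x₀ i) ^ 2)) ^ m := by
        funext s
        simp only [hu]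
        congr 2
        rw [hDdef, hR, ← Finset.add_sum_erase _ _ (Finset.mem_univ i),
          ← Finset.add_sum_erase _ (fun j => (x j - x₀ j) ^ 2) (Finset.mem_univ i)]
        have : ∑ j ∈ Finset.univ.erase i, (Function.update x i s j - x₀ j) ^ 2
            = ∑ j ∈ Finset.univ.erase i, (x j - x₀ j) ^ 2 := by
          refine Finset.sum_congr rfl fun j hj => ?_
          rw [Function.update_of_ne (Finset.ne_of_mem_erase hj)]
        rw [this]
        simp only [Function.update_self]
        ring
      have hq : (D - (x i - x₀ i) ^ 2) + 0 * x i + 1 * (x i - x₀ i) ^ 2 = D := by ring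
      unfold pdxx
      rw [hfun, aux_d2 C m _ _ _ _ (x i) hC (by rw [hq]; exact h), hq]
      ring
    have e4 : u (x, y) ^ α = (C / D) ^ m * (C ^ 2 / D ^ 2) := by
      have hpos : 0 < C / D := div_pos hC h
      have : u (x, y) = (C / D) ^ m := by simp only [hu, ← hR, ← hDdef]
      rw [this, ← Real.rpow_mul hpos.le]
      have : m * α = m + 2 := by
        rw [hα, hmdef]
        field_simp
        ring
      rw [this, Real.rpow_add hpos, ← div_pow]
      norm_cast
    have e5 : ∑ i, pdxx n u i x y = (m * (m + 1) * 4 * R - n * (2 * m * D)) / D ^ 2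
        * (C / D) ^ m := by
      rw [Finset.sum_congr rfl fun i _ => e3 i, ← Finset.sum_mul, ← Finset.sum_div,
        Finset.sum_sub_distrib, ← Finset.mul_sum, ← hR]
      simp
    rw [e1, e2, e4, e5, hC2]
    have hn' : (n : ℝ) = 2 * m + 2 - 2 * a := by rw [hmdef]; ring
    have hR' : R = D - t ^ 2 - 4 * y := by rw [hDdef]; ring
    rw [hn', hR']
    field_simp
    ring
end

section
/- Let n ≥ 1 and a > 1, let α > 1, and set τ = n + 2a + 2 − α(n+2a−2). Suppose ū ∈ C²(ℝ^{n+1}) satisfies Δū + ((2a−1)/x_{n+1})∂_{n+1}ū + ū^α = 0 at every point with x_{n+1} ≠ 0, and ∂_{n+1}ū(x',0) = 0 for all x' ∈ ℝⁿ. Define v(x) = |x|^{−(n+2a−2)}·ū(x/|x|²) for x ∈ ℝ^{n+1} \ {0}. Then v satisfies Δv + ((2a−1)/x_{n+1})∂_{n+1}v + |x|^{−τ}v^α = 0 at every point of ℝ^{n+1} \ {0} with x_{n+1} ≠ 0, and ∂_{n+1}v(x',0) = 0 for all x' ∈ ℝⁿ \ {0}. -/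
open scoped InnerProductSpace

lemma fderiv_of_line {E : Type*} [NormedAddCommGroup E] [NormedSpace ℝ E] {f : E → ℝ} {x e : E}
    {c : ℝ} (hf : DifferentiableAt ℝ f x) (h : HasDerivAt (fun t : ℝ => f (x + t • e)) c 0) :
    fderiv ℝ f x e = c := by
  have h1 : HasLineDerivAt ℝ f (fderiv ℝ f x e) x e := hf.hasFDerivAt.hasLineDerivAt e
  exact HasDerivAt.unique h1 h

section
variable {E : Type*} [NormedAddCommGroup E] [InnerProductSpace ℝ E]

lemma line_hd (x e : E) : HasDerivAt (fun t : ℝ => x + t • e) e 0 := by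
  simpa using ((hasDerivAt_id (0:ℝ)).smul_const e).const_add x

lemma q_hd (x e : E) : HasDerivAt (fun t : ℝ => ‖x + t • e‖ ^ 2) (2 * ⟪x, e⟫_ℝ) 0 := by
  simpa using (line_hd x e).norm_sq

lemma qp_hd (x e : E) (hx : x ≠ 0) (p : ℝ) :
    HasDerivAt (fun t : ℝ => (‖x + t • e‖ ^ 2) ^ p)
      (2 * p * ⟪x, e⟫_ℝ * (‖x‖ ^ 2) ^ (p - 1)) 0 := by
  have := (q_hd x e).rpow_const (p := p) (Or.inl (by simpa using hx))
  refine HasDerivAt.congr_deriv this ?_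
  simp only [zero_smul, add_zero]; ring

lemma y_hd (x e : E) (hx : x ≠ 0) :
    HasDerivAt (fun t : ℝ => (‖x + t • e‖ ^ 2)⁻¹ • (x + t • e))
      ((‖x‖ ^ 2)⁻¹ • (e - (2 * ⟪x, e⟫_ℝ / ‖x‖ ^ 2) • x)) 0 := by
  have h0 : ‖x‖ ≠ 0 := by simpa using hx
  have := ((q_hd x e).inv (by simpa using hx)).smul (line_hd x e)
  refine HasDerivAt.congr_deriv this ?_
  simp only [zero_smul, add_zero, Pi.inv_apply]
  rw [smul_sub, smul_smul, sub_eq_add_neg, ← neg_smul]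
  congr 2
  field_simp

lemma y_diff (x : E) (hx : x ≠ 0) : DifferentiableAt ℝ (fun z : E => (‖z‖ ^ 2)⁻¹ • z) x := by
  have h0 : ‖x‖ ^ 2 ≠ 0 := by simpa using hx
  have h1 : DifferentiableAt ℝ (fun z : E => ‖z‖ ^ 2) x := differentiableAt_id.norm_sq ℝ
  exact (h1.inv h0).smul differentiableAt_id

lemma qp_diff (x : E) (hx : x ≠ 0) (p : ℝ) :
    DifferentiableAt ℝ (fun z : E => (‖z‖ ^ 2) ^ p) x := by
  have h0 : ‖x‖ ^ 2 ≠ 0 := by simpa using hx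
  have h1 : DifferentiableAt ℝ (fun z : E => ‖z‖ ^ 2) x := differentiableAt_id.norm_sq ℝ
  exact h1.rpow_const (Or.inl h0)

lemma fderiv_v (u : E → ℝ) (hu : ContDiff ℝ 2 u) (k : ℝ) (x e : E) (hx : x ≠ 0) :
    fderiv ℝ (fun z : E => (‖z‖ ^ 2) ^ (-k / 2) * u ((‖z‖ ^ 2)⁻¹ • z)) x e =
      (‖x‖ ^ 2) ^ (-k / 2 - 1) * (-k * ⟪x, e⟫_ℝ * u ((‖x‖ ^ 2)⁻¹ • x)
        + fderiv ℝ u ((‖x‖ ^ 2)⁻¹ • x) e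
        - 2 * ⟪x, e⟫_ℝ * (‖x‖ ^ 2)⁻¹ * fderiv ℝ u ((‖x‖ ^ 2)⁻¹ • x) x) := by
  have hud : Differentiable ℝ u := hu.differentiable (by norm_num)
  have h0 : 0 < ‖x‖ ^ 2 := by positivity
  apply fderiv_of_line
  · exact (qp_diff x hx _).mul ((hud _).comp x (y_diff x hx))
  · have h1 := (hud ((‖x‖ ^ 2)⁻¹ • x)).hasFDerivAt.comp_hasDerivAt_of_eq 0 (y_hd x e hx)
      (by simp)
    have := (qp_hd x e hx (-k / 2)).mul h1
    refine HasDerivAt.congr_deriv this ?_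
    simp only [map_smul, map_sub, smul_eq_mul, zero_smul, add_zero, Function.comp]
    rw [Real.rpow_sub h0, Real.rpow_one]
    field_simp
    ring

lemma fderiv2_v (u : E → ℝ) (hu : ContDiff ℝ 2 u) (k : ℝ) (x e : E) (hx : x ≠ 0)
    (he : ⟪e, e⟫_ℝ = 1) :
    fderiv ℝ (fun w => fderiv ℝ (fun z : E => (‖z‖ ^ 2) ^ (-k / 2) * u ((‖z‖ ^ 2)⁻¹ • z)) w e) x e
     = (‖x‖ ^ 2) ^ (-k / 2 - 1) * (
      -(k + 2) * (‖x‖ ^ 2)⁻¹ * ⟪x, e⟫_ℝ * (-k * ⟪x, e⟫_ℝ * u ((‖x‖ ^ 2)⁻¹ • x)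
        + fderiv ℝ u ((‖x‖ ^ 2)⁻¹ • x) e
        - 2 * ⟪x, e⟫_ℝ * (‖x‖ ^ 2)⁻¹ * fderiv ℝ u ((‖x‖ ^ 2)⁻¹ • x) x)
      + (- k * u ((‖x‖ ^ 2)⁻¹ • x)
        - k * ⟪x, e⟫_ℝ * (‖x‖ ^ 2)⁻¹ * (fderiv ℝ u ((‖x‖ ^ 2)⁻¹ • x) e
            - 2 * ⟪x, e⟫_ℝ * (‖x‖ ^ 2)⁻¹ * fderiv ℝ u ((‖x‖ ^ 2)⁻¹ • x) x)
        + (‖x‖ ^ 2)⁻¹ * (fderiv ℝ (fderiv ℝ u) ((‖x‖ ^ 2)⁻¹ • x) e e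
            - 2 * ⟪x, e⟫_ℝ * (‖x‖ ^ 2)⁻¹ * fderiv ℝ (fderiv ℝ u) ((‖x‖ ^ 2)⁻¹ • x) x e)
        - 2 * (‖x‖ ^ 2)⁻¹ * fderiv ℝ u ((‖x‖ ^ 2)⁻¹ • x) x
        + 4 * ⟪x, e⟫_ℝ ^ 2 * (‖x‖ ^ 2)⁻¹ ^ 2 * fderiv ℝ u ((‖x‖ ^ 2)⁻¹ • x) x
        - 2 * ⟪x, e⟫_ℝ * (‖x‖ ^ 2)⁻¹ * (fderiv ℝ u ((‖x‖ ^ 2)⁻¹ • x) e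
           + (‖x‖ ^ 2)⁻¹ * (fderiv ℝ (fderiv ℝ u) ((‖x‖ ^ 2)⁻¹ • x) e x
            - 2 * ⟪x, e⟫_ℝ * (‖x‖ ^ 2)⁻¹ * fderiv ℝ (fderiv ℝ u) ((‖x‖ ^ 2)⁻¹ • x) x x)))) := by
  have hud : Differentiable ℝ u := hu.differentiable (by norm_num)
  have hud2 : Differentiable ℝ (fderiv ℝ u) :=
    (hu.fderiv_right (m := 1) (by norm_num)).differentiable (by norm_num)
  have h0 : 0 < ‖x‖ ^ 2 := by positivity
  have hev : (fun w => fderiv ℝ (fun z : E => (‖z‖ ^ 2) ^ (-k / 2) * u ((‖z‖ ^ 2)⁻¹ • z)) w e)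
      =ᶠ[nhds x] (fun x => (‖x‖ ^ 2) ^ (-k / 2 - 1) * (-k * ⟪x, e⟫_ℝ * u ((‖x‖ ^ 2)⁻¹ • x)
        + fderiv ℝ u ((‖x‖ ^ 2)⁻¹ • x) e
        - 2 * ⟪x, e⟫_ℝ * (‖x‖ ^ 2)⁻¹ * fderiv ℝ u ((‖x‖ ^ 2)⁻¹ • x) x)) := by
    filter_upwards [isOpen_ne.mem_nhds hx] with w hw
    exact fderiv_v u hu k w e hw
  rw [hev.fderiv_eq]
  apply fderiv_of_line
  · have hi : DifferentiableAt ℝ (fun x : E => ⟪x, e⟫_ℝ) x :=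
      differentiableAt_id.inner ℝ (differentiableAt_const e)
    have h1 : DifferentiableAt ℝ (fun z : E => (‖z‖ ^ 2)⁻¹) x :=
      (differentiableAt_id.norm_sq ℝ).inv h0.ne'
    have h2 : DifferentiableAt ℝ (fun z : E => u ((‖z‖ ^ 2)⁻¹ • z)) x :=
      (hud _).comp x (y_diff x hx)
    have h3 : DifferentiableAt ℝ (fun z : E => fderiv ℝ u ((‖z‖ ^ 2)⁻¹ • z)) x :=
      (hud2 _).comp x (y_diff x hx)
    exact (qp_diff x hx _).mul ((((hi.const_mul _).mul h2).add
      (h3.clm_apply (differentiableAt_const e))).sub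
      (((hi.const_mul _).mul h1).mul (h3.clm_apply differentiableAt_id)))
  · have h1 := (hud ((‖x‖ ^ 2)⁻¹ • x)).hasFDerivAt.comp_hasDerivAt_of_eq 0 (y_hd x e hx)
      (by simp)
    have h2 := (hud2 ((‖x‖ ^ 2)⁻¹ • x)).hasFDerivAt.comp_hasDerivAt_of_eq 0 (y_hd x e hx)
      (by simp)
    have hi : HasDerivAt (fun t : ℝ => ⟪x + t • e, e⟫_ℝ) 1 0 := by
      have := (line_hd x e).inner ℝ (hasDerivAt_const (0:ℝ) e)
      simpa only [inner_zero_right, zero_add, he] using this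
    have hq := (q_hd x e).inv (by simpa using hx)
    have := (qp_hd x e hx (-k / 2 - 1)).mul ((((hi.const_mul (-k)).mul h1).add
      (h2.clm_apply (hasDerivAt_const (0:ℝ) e))).sub
      (((hi.const_mul 2).mul hq).mul (h2.clm_apply (line_hd x e))))
    refine HasDerivAt.congr_deriv this ?_
    simp only [map_smul, map_sub, smul_eq_mul, zero_smul, add_zero, Function.comp, Pi.inv_apply,
      smul_apply, sub_apply, map_zero, Pi.mul_apply,
      Pi.add_apply, Pi.sub_apply]
    rw [Real.rpow_sub h0 _ 1, Real.rpow_sub h0 _ 1, Real.rpow_one]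
    field_simp
    ring

end

/-- The Kelvin-transform computation: equation (103) transforms into equation (104)
under `v(x) = |x|^{-(n+2a-2)} ū(x/|x|²)`. -/
theorem kelvin_transform (n : ℕ) (hn : 1 ≤ n) (a α τ : ℝ) (ha : 1 < a) (hα : 1 < α)
    (hτ : τ = n + 2 * a + 2 - α * (n + 2 * a - 2))
    (ubar : EuclideanSpace ℝ (Fin (n + 1)) → ℝ)
    (hreg : ContDiff ℝ 2 ubar)
    (hnonneg : ∀ x, 0 ≤ ubar x)
    (heq : ∀ x : EuclideanSpace ℝ (Fin (n + 1)), x (Fin.last n) ≠ 0 →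
      (∑ i, pd2 ubar i i x) + ((2 * a - 1) / x (Fin.last n)) * pd ubar (Fin.last n) x +
        ubar x ^ α = 0)
    (hbdry : ∀ x : EuclideanSpace ℝ (Fin (n + 1)), x (Fin.last n) = 0 →
      pd ubar (Fin.last n) x = 0)
    (v : EuclideanSpace ℝ (Fin (n + 1)) → ℝ)
    (hv : v = fun x => ‖x‖ ^ (-((n : ℝ) + 2 * a - 2)) * ubar ((‖x‖ ^ 2)⁻¹ • x)) :
    (∀ x : EuclideanSpace ℝ (Fin (n + 1)), x ≠ 0 → x (Fin.last n) ≠ 0 →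
      (∑ i, pd2 v i i x) + ((2 * a - 1) / x (Fin.last n)) * pd v (Fin.last n) x +
        ‖x‖ ^ (-τ) * v x ^ α = 0) ∧
    (∀ x : EuclideanSpace ℝ (Fin (n + 1)), x ≠ 0 → x (Fin.last n) = 0 →
      pd v (Fin.last n) x = 0) := by
  have hveq : v = fun z => (‖z‖ ^ 2) ^ (-((n : ℝ) + 2 * a - 2) / 2) * ubar ((‖z‖ ^ 2)⁻¹ • z) := by
    rw [hv]; funext z
    congr 1
    rw [← Real.rpow_natCast, ← Real.rpow_mul (norm_nonneg z)]
    congr 1; push_cast; ring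
  have hin : ∀ (x : EuclideanSpace ℝ (Fin (n + 1))) i, ⟪x, EuclideanSpace.single i (1:ℝ)⟫_ℝ = x i := by
    intro x i; simp [EuclideanSpace.inner_single_right]
  have hpd : ∀ x : EuclideanSpace ℝ (Fin (n + 1)), x ≠ 0 → ∀ i, _ := fun x hx i =>
    fderiv_v ubar hreg ((n : ℝ) + 2 * a - 2) x (EuclideanSpace.single i 1) hx
  have hpd2 : ∀ x : EuclideanSpace ℝ (Fin (n + 1)), x ≠ 0 → ∀ i, _ := fun x hx i =>
    fderiv2_v ubar hreg ((n : ℝ) + 2 * a - 2) x (EuclideanSpace.single i 1) hx (by simp)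
  rw [← hveq] at hpd hpd2
  simp only [hin] at hpd hpd2
  constructor
  · intro x hx hxl
    have h0 : 0 < ‖x‖ ^ 2 := by positivity
    have hxs : x = ∑ i, x i • EuclideanSpace.single i (1:ℝ) := by
      ext j; simp [Finset.sum_apply, Pi.single_apply]
    have hsum : ∀ L : EuclideanSpace ℝ (Fin (n + 1)) →L[ℝ] ℝ,
        ∑ i, x i * L (EuclideanSpace.single i 1) = L x := by
      intro L
      conv_rhs => rw [hxs]
      simp
    have hsq : ∑ i, x i ^ 2 = ‖x‖ ^ 2 := by
      rw [EuclideanSpace.real_norm_sq_eq]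
    have hud2 : Differentiable ℝ (fderiv ℝ ubar) :=
      (hreg.fderiv_right (m := 1) (by norm_num)).differentiable (by norm_num)
    have hu2 : ∀ y i, pd2 ubar i i y = fderiv ℝ (fderiv ℝ ubar) y (EuclideanSpace.single i 1)
        (EuclideanSpace.single i 1) := by
      intro y i
      have := ((hud2 y).hasFDerivAt.clm_apply
        (hasFDerivAt_const (EuclideanSpace.single i (1:ℝ)) y)).fderiv
      simp only [pd2, pd]
      rw [this]; simp
    have hy := heq ((‖x‖ ^ 2)⁻¹ • x) (by simp [hxl, hx])
    simp only [hu2] at hy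
    have hvx : ‖x‖ ^ (-τ) * v x ^ α = (‖x‖ ^ 2) ^ (-((n : ℝ) + 2 * a - 2) / 2 - 1) * (‖x‖ ^ 2)⁻¹ *
        ubar ((‖x‖ ^ 2)⁻¹ • x) ^ α := by
      have e1 : ‖x‖ ^ (-τ) = (‖x‖ ^ 2) ^ (-τ / 2) := by
        rw [← Real.rpow_natCast, ← Real.rpow_mul (norm_nonneg x)]
        congr 1; push_cast; ring
      rw [hveq, e1]
      simp only
      rw [Real.mul_rpow (by positivity) (hnonneg _), ← Real.rpow_mul h0.le, ← mul_assoc,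
        ← Real.rpow_add h0, ← Real.rpow_neg_one (‖x‖ ^ 2), ← Real.rpow_add h0]
      congr 2
      rw [hτ]; ring
    rw [hvx]
    have hl : pd v (Fin.last n) x = _ := hpd x hx (Fin.last n)
    have hl2 : ∀ i, pd2 v i i x = _ := fun i => hpd2 x hx i
    rw [hl]
    simp only [hl2, ← Finset.mul_sum]
    simp only [pd, PiLp.smul_apply, smul_eq_mul] at hy
    set s := ‖x‖ ^ 2 with hs
    set y := s⁻¹ • x with hydef
    set D := fderiv ℝ ubar y
    set H := fderiv ℝ (fderiv ℝ ubar) y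
    have S1 := hsum D
    have S2 := hsum (H x)
    have S3 := hsum (H.flip x)
    simp only [ContinuousLinearMap.flip_apply] at S3
    set P := s ^ (-((n : ℝ) + 2 * a - 2) / 2 - 1)
    set k := (n : ℝ) + 2 * a - 2 with hk
    have key : ∀ i, (-(k + 2) * s⁻¹ * x i * (-k * x i * ubar y + D (EuclideanSpace.single i 1)
          - 2 * x i * s⁻¹ * D x)
        + (-k * ubar y - k * x i * s⁻¹ * (D (EuclideanSpace.single i 1) - 2 * x i * s⁻¹ * D x)
        + s⁻¹ * (H (EuclideanSpace.single i 1) (EuclideanSpace.single i 1)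
            - 2 * x i * s⁻¹ * H x (EuclideanSpace.single i 1))
        - 2 * s⁻¹ * D x + 4 * x i ^ 2 * s⁻¹ ^ 2 * D x
        - 2 * x i * s⁻¹ * (D (EuclideanSpace.single i 1)
           + s⁻¹ * (H (EuclideanSpace.single i 1) x - 2 * x i * s⁻¹ * H x x))))
      = x i ^ 2 * ((k + 2) * k * s⁻¹ * ubar y + (2 * (k + 2) + 2 * k + 4) * s⁻¹ ^ 2 * D x
          + 4 * s⁻¹ ^ 3 * H x x)
        + x i * D (EuclideanSpace.single i 1) * (- (2 * k + 4) * s⁻¹)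
        + (- k * ubar y - 2 * s⁻¹ * D x)
        + s⁻¹ * H (EuclideanSpace.single i 1) (EuclideanSpace.single i 1)
        + x i * H x (EuclideanSpace.single i 1) * (- 2 * s⁻¹ ^ 2)
        + x i * H (EuclideanSpace.single i 1) x * (- 2 * s⁻¹ ^ 2) := by
      intro i; ring
    simp only [key, Finset.sum_add_distrib, ← Finset.sum_mul, ← Finset.mul_sum, S1, S2, S3, hsq,
      Finset.sum_const, Finset.card_univ, Fintype.card_fin, nsmul_eq_mul]
    have hy' : ∑ i, H (EuclideanSpace.single i 1) (EuclideanSpace.single i 1) =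
      - ((2 * a - 1) / (s⁻¹ * x (Fin.last n)) * D (EuclideanSpace.single (Fin.last n) 1))
       - ubar y ^ α := by linarith
    rw [hy']
    have hs0 : s ≠ 0 := h0.ne'
    generalize ubar y ^ α = U
    rw [hk]
    push_cast
    field_simp
    ring
  · intro x hx hxl
    have hl : pd v (Fin.last n) x = _ := hpd x hx (Fin.last n)
    have := hbdry ((‖x‖ ^ 2)⁻¹ • x) (by simp [hxl])
    rw [pd] at this
    rw [hl, hxl, this]
    simp
end

section
/- Let n ≥ 1, let a be a constant, and let λ₀ ∈ ℝ. Define h(x) = (λ₀ − x₁)/|x − λ₀e₁|^{n+2a} for x ∈ ℝ^{n+1} \ {λ₀e₁}, where e₁ = (1,0,…,0). Then Δh + ((2a−1)/x_{n+1})∂_{n+1}h = 0 at every point of ℝ^{n+1} \ {λ₀e₁} with x_{n+1} ≠ 0. -/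
open Filter Topology in
lemma hasFDerivAt_N {m : ℕ} (c z : EuclideanSpace ℝ (Fin m)) (hz : z ≠ c) (s : ℝ) :
    HasFDerivAt (fun z : EuclideanSpace ℝ (Fin m) => (‖z - c‖ ^ 2) ^ s)
      ((s * (‖z - c‖ ^ 2) ^ (s - 1)) • ((2 : ℝ) • (innerSL ℝ (z - c)))) z := by
  have h1 : HasFDerivAt (fun z : EuclideanSpace ℝ (Fin m) => ‖z - c‖ ^ 2)
      ((2 : ℝ) • (innerSL ℝ (z - c))) z := by
    have := ((hasFDerivAt_id z).sub_const c).norm_sq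
    refine this.congr_fderiv ?_
    ext v
    simp [two_smul, two_mul]
  have hne : ‖z - c‖ ^ 2 ≠ 0 := by
    have := norm_ne_zero_iff.mpr (sub_ne_zero.mpr hz)
    positivity
  exact h1.rpow_const (Or.inl hne)

lemma hasFDerivAt_coord {m : ℕ} (j : Fin m) (z : EuclideanSpace ℝ (Fin m)) :
    HasFDerivAt (fun z : EuclideanSpace ℝ (Fin m) => z j)
      (EuclideanSpace.proj j : EuclideanSpace ℝ (Fin m) →L[ℝ] ℝ) z :=
  (EuclideanSpace.proj j : EuclideanSpace ℝ (Fin m) →L[ℝ] ℝ).hasFDerivAt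

lemma pd_first {n : ℕ} (c z : EuclideanSpace ℝ (Fin (n+1))) (hz : z ≠ c) (s l : ℝ)
    (j : Fin (n+1)) :
    pd (fun z => (l - z 0) * (‖z - c‖ ^ 2) ^ s) j z =
      - (if j = 0 then 1 else 0) * (‖z - c‖ ^ 2) ^ s +
        2 * s * ((l - z 0) * ((z j - c j) * (‖z - c‖ ^ 2) ^ (s - 1))) := by
  have h : HasFDerivAt (fun z => (l - z 0) * (‖z - c‖ ^ 2) ^ s) _ z :=
    ((hasFDerivAt_coord 0 z).const_sub l).mul (hasFDerivAt_N c z hz s)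
  unfold pd
  rw [HasFDerivAt.fderiv h]
  simp [EuclideanSpace.inner_single_right, Pi.single_apply, eq_comm]
  split_ifs <;> ring

lemma pd_second {n : ℕ} (c z : EuclideanSpace ℝ (Fin (n+1))) (hz : z ≠ c) (s l : ℝ)
    (j : Fin (n+1)) :
    pd2 (fun z => (l - z 0) * (‖z - c‖ ^ 2) ^ s) j j z =
      (if j = 0 then - (4 * s * (z j - c j) * (‖z - c‖ ^ 2) ^ (s - 1)) else 0) +
        2 * s * (l - z 0) * ((‖z - c‖ ^ 2) ^ (s - 1) +
          2 * (s - 1) * (‖z - c‖ ^ 2) ^ (s - 1 - 1) * (z j - c j) ^ 2) := by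
  have h0 := ((hasFDerivAt_N c z hz s).const_mul (- (if j = 0 then (1:ℝ) else 0))).add
    ((((hasFDerivAt_coord 0 z).const_sub l).mul
      (((hasFDerivAt_coord j z).sub_const (c j)).mul (hasFDerivAt_N c z hz (s-1)))).const_mul (2*s))
  have he : (fun z => pd (fun z => (l - z 0) * (‖z - c‖ ^ 2) ^ s) j z) =ᶠ[nhds z] _ :=
    (eventually_ne_nhds hz).mono (fun w hw => pd_first c w hw s l j)
  have h := h0.congr_of_eventuallyEq he
  unfold pd2
  rw [pd, HasFDerivAt.fderiv h]
  by_cases hj : j = 0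
  · subst hj
    simp [EuclideanSpace.inner_single_right]
    ring
  · simp [EuclideanSpace.inner_single_right, hj, Ne.symm hj]
    ring

/-- The barrier identity used in Lemma 2.4: the function
`h(x) = (λ₀ - x₁)/|x - λ₀ e₁|^{n+2a}` is annihilated by the degenerate operator
`Δ + ((2a-1)/x_{n+1}) ∂_{n+1}` away from its singular point. -/
theorem barrier_identity (n : ℕ) (hn : 1 ≤ n) (a lam₀ : ℝ)
    (h : EuclideanSpace ℝ (Fin (n + 1)) → ℝ)
    (hh : h = fun x => (lam₀ - x 0) /
      ‖x - lam₀ • (EuclideanSpace.single 0 (1 : ℝ))‖ ^ ((n : ℝ) + 2 * a)) :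
    ∀ x : EuclideanSpace ℝ (Fin (n + 1)),
      x ≠ lam₀ • (EuclideanSpace.single 0 (1 : ℝ)) → x (Fin.last n) ≠ 0 →
      (∑ i, pd2 h i i x) + ((2 * a - 1) / x (Fin.last n)) * pd h (Fin.last n) x = 0 := by
  intro x hx hl
  set c : EuclideanSpace ℝ (Fin (n + 1)) := lam₀ • (EuclideanSpace.single 0 (1 : ℝ)) with hc
  have hform : h = fun z => (lam₀ - z 0) * (‖z - c‖ ^ 2) ^ (-((n : ℝ) + 2 * a) / 2) := by
    rw [hh]
    funext z
    rw [div_eq_mul_inv, ← Real.rpow_neg (norm_nonneg _), ← Real.rpow_natCast,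
      ← Real.rpow_mul (norm_nonneg _)]
    congr 2
    push_cast
    ring
  have hlast : Fin.last n ≠ 0 := by
    intro h0
    have := congrArg Fin.val h0
    simp at this
    omega
  have hN : ‖x - c‖ ^ 2 ≠ 0 := by
    have := norm_ne_zero_iff.mpr (sub_ne_zero.mpr hx)
    positivity
  have hsum : ∑ i, (x i - c i) ^ 2 = ‖x - c‖ ^ 2 := by
    rw [EuclideanSpace.norm_sq_eq]
    simp
  have hcl : c (Fin.last n) = 0 := by simp [hc, hlast]
  have hc0 : c 0 = lam₀ := by simp [hc]
  rw [hform, pd_first c x hx]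
  simp_rw [pd_second c x hx]
  rw [Finset.sum_add_distrib, ← Finset.mul_sum, Finset.sum_add_distrib, ← Finset.mul_sum, hsum,
    Finset.sum_ite_eq' Finset.univ (0 : Fin (n+1))]
  simp only [Finset.mem_univ, if_true, hlast, if_false, hcl, hc0, Finset.sum_const,
    Finset.card_univ, Fintype.card_fin, nsmul_eq_mul]
  rw [mul_assoc (2 * (_ - 1)), ← Real.rpow_add_one hN]
  push_cast
  generalize x (Fin.last n) = t at hl
  rw [sub_add_cancel]
  field_simp
  ring
end
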